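/- Let D and E be separable unital C*-algebras. (i) If D and E both have approximately inner flip, then the minimal tensor product D ⊗ E has approximately inner flip. (ii) If D and E both have approximately inner half flip, then D ⊗ E has approximately inner half flip. (iii) If D and E are strongly self-absorbing, then D ⊗ E is strongly self-absorbing. -/

import Mathlib

open scoped MultiplierAlgebra TensorProduct
open Filter Topology

noncomputable section

universe u v w x

/-- Approximate unitary equivalence of two maps `φ ψ : A → B`, witnessed by a sequence of
unitaries in the multiplier algebra `𝓜(ℂ, B)` (in which `B` embeds canonically). -/
def ApproxUnitaryEquiv {A : Type u} {B : Type v} [NonUnitalCStarAlgebra B]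
    (φ ψ : A → B) : Prop :=
  ∃ v : ℕ → 𝓜(ℂ, B), (∀ n, v n ∈ unitary 𝓜(ℂ, B)) ∧
    ∀ a : A, Tendsto
      (fun n => ‖star (v n) * (φ a : 𝓜(ℂ, B)) * v n - (ψ a : 𝓜(ℂ, B))‖)
      atTop (𝓝 (0 : ℝ))

/-- Data exhibiting `T` as a C*-tensor product of `A` and `B`: a bilinear, multiplicative,
star-preserving, cross-normed map `A × B → T` with dense span. -/
structure CStarTensor (A : Type u) (B : Type v) (T : Type w) [NonUnitalCStarAlgebra A]
    [NonUnitalCStarAlgebra B] [NonUnitalCStarAlgebra T] where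
  tmul : A → B → T
  add_left : ∀ a a' b, tmul (a + a') b = tmul a b + tmul a' b
  add_right : ∀ a b b', tmul a (b + b') = tmul a b + tmul a b'
  smul_left : ∀ (c : ℂ) a b, tmul (c • a) b = c • tmul a b
  smul_right : ∀ (c : ℂ) a b, tmul a (c • b) = c • tmul a b
  mul_tmul : ∀ a a' b b', tmul a b * tmul a' b' = tmul (a * a') (b * b')
  star_tmul : ∀ a b, star (tmul a b) = tmul (star a) (star b)
  norm_tmul : ∀ a b, ‖tmul a b‖ = ‖a‖ * ‖b‖
  dense_span : Dense ((Submodule.span ℂ {t : T | ∃ a b, tmul a b = t} : Submodule ℂ T) : Set T)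

/-- Data exhibiting `T` as *the minimal (spatial) tensor product* of `A` and `B`: a C*-tensor
product which is dominated by every other C*-tensor product of `A` and `B` (i.e., it carries
the smallest C*-norm). -/
structure MinTensor (A : Type u) (B : Type v) (T : Type w) [NonUnitalCStarAlgebra A]
    [NonUnitalCStarAlgebra B] [NonUnitalCStarAlgebra T] extends CStarTensor A B T where
  minimal : ∀ (T' : Type (max u v)) [NonUnitalCStarAlgebra T'] (h : CStarTensor A B T'),
    ∃ π : T' →⋆ₙₐ[ℂ] T, ∀ a b, π (h.tmul a b) = tmul a b

/-- The first-factor unital embedding `d ↦ d ⊗ 1`. -/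
def MinTensor.fst {D : Type u} {E : Type v} {T : Type w} [CStarAlgebra D] [CStarAlgebra E]
    [CStarAlgebra T] (h : MinTensor D E T) : D → T := fun d => h.tmul d 1

/-- The second-factor unital embedding `d ↦ 1 ⊗ d`. -/
def MinTensor.snd {D : Type u} {E : Type v} {T : Type w} [CStarAlgebra D] [CStarAlgebra E]
    [CStarAlgebra T] (h : MinTensor D E T) : E → T := fun d => h.tmul 1 d

/-- A unital C*-algebra `D` has *approximately inner half flip* (with respect to a
realization `T` of the minimal tensor product `D ⊗ D`) if the two factor embeddings
`id_D ⊗ 1_D` and `1_D ⊗ id_D` of `D` into `D ⊗ D` are approximately unitarily equivalent. -/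
def HasApproxInnerHalfFlip {D : Type u} {T : Type w} [CStarAlgebra D] [CStarAlgebra T]
    (h : MinTensor D D T) : Prop :=
  ApproxUnitaryEquiv h.fst h.snd

/-- A unital C*-algebra `D` has *approximately inner flip* (with respect to a realization
`T` of `D ⊗ D`) if the flip automorphism `σ_D : a ⊗ b ↦ b ⊗ a` of `D ⊗ D` is approximately
unitarily equivalent to the identity map. -/
def HasApproxInnerFlip {D : Type u} {T : Type w} [CStarAlgebra D] [CStarAlgebra T]
    (h : MinTensor D D T) : Prop :=
  ∃ σ : T ≃⋆ₐ[ℂ] T, (∀ a b, σ (h.tmul a b) = h.tmul b a) ∧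
    ApproxUnitaryEquiv (⇑σ) (id : T → T)

/-- A unital C*-algebra `D ≇ ℂ` is *strongly self-absorbing* (with respect to a realization
`T` of the minimal tensor product `D ⊗ D`) if there is an isomorphism `φ : D → D ⊗ D` which
is approximately unitarily equivalent to `id_D ⊗ 1_D`. -/
def IsStronglySelfAbsorbing {D : Type u} {T : Type w} [CStarAlgebra D] [CStarAlgebra T]
    (h : MinTensor D D T) : Prop :=
  IsEmpty (D ≃⋆ₐ[ℂ] ℂ) ∧ ∃ φ : D ≃⋆ₐ[ℂ] T, ApproxUnitaryEquiv (⇑φ) h.fst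

open scoped ComplexOrder InnerProductSpace

theorem re_inner_self_complex {H : Type*} [NormedAddCommGroup H] [InnerProductSpace ℂ H] (x : H) :
    (⟪x, x⟫_ℂ).re = ‖x‖ ^ 2 :=
  inner_self_eq_norm_sq (𝕜 := ℂ) x

/-- Positivity of a linear functional on a star algebra, without reference to an order. -/
def IsPosFun {A : Type u} [CStarAlgebra A] (f : A →ₗ[ℂ] ℂ) : Prop :=
  ∀ a, 0 ≤ f (star a * a)

/-- The GNS construction, packaged without reference to an order on the algebra. -/
theorem IsPosFun.exists_gns {A : Type u} [CStarAlgebra A] {f : A →ₗ[ℂ] ℂ} (hf : IsPosFun f) :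
    ∃ (H : Type u) (_ : NormedAddCommGroup H) (_ : InnerProductSpace ℂ H) (_ : CompleteSpace H)
      (π : A →⋆ₐ[ℂ] (H →L[ℂ] H)) (v : A →ₗ[ℂ] H), DenseRange v ∧
      (∀ a b, π a (v b) = v (a * b)) ∧ ∀ a b, ⟪v a, v b⟫_ℂ = f (star a * b) := by
  let _ := CStarAlgebra.spectralOrder A
  let _ := CStarAlgebra.spectralOrderedRing A
  let F : A →ₚ[ℂ] ℂ := PositiveLinearMap.mk₀ f fun a ha => by
    obtain ⟨b, rfl⟩ := CStarAlgebra.nonneg_iff_eq_star_mul_self.mp ha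
    exact hf b
  refine ⟨F.GNS, inferInstance, inferInstance, inferInstance, F.gnsStarAlgHom,
    (UniformSpace.Completion.toComplL (𝕜 := ℂ) (E := F.PreGNS)).toLinearMap ∘ₗ
      F.toPreGNS.toLinearMap, ?_, ?_, ?_⟩
  · exact (UniformSpace.Completion.denseRange_coe (α := F.PreGNS)).comp
      F.toPreGNS.surjective.denseRange (UniformSpace.Completion.continuous_coe _)
  · intro a b
    simp
  · intro a b
    simp [PositiveLinearMap.preGNS_inner_def]
    rfl

namespace IsPosFun

variable {A : Type u} [CStarAlgebra A] {f : A →ₗ[ℂ] ℂ}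

theorem re_nonneg (hf : IsPosFun f) (a : A) : 0 ≤ (f (star a * a)).re :=
  (Complex.nonneg_iff.mp (hf a)).1

theorem im_eq_zero (hf : IsPosFun f) (a : A) : (f (star a * a)).im = 0 :=
  (Complex.nonneg_iff.mp (hf a)).2.symm

theorem map_star (hf : IsPosFun f) (a : A) : f (star a) = star (f a) := by
  obtain ⟨H, _, _, _, π, v, -, -, hv⟩ := hf.exists_gns
  have h1 := hv a 1
  have h2 := hv 1 a
  rw [mul_one] at h1
  rw [star_one, one_mul] at h2
  rw [← h1, ← h2, ← inner_conj_symm]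
  rfl

theorem conj_le (hf : IsPosFun f) (a c : A) :
    (f (star c * (star a * a) * c)).re ≤ ‖a‖ ^ 2 * (f (star c * c)).re := by
  obtain ⟨H, _, _, _, π, v, -, hπ, hv⟩ := hf.exists_gns
  have h1 : f (star c * (star a * a) * c) = ⟪v (a * c), v (a * c)⟫_ℂ := by
    rw [hv]; simp [mul_assoc]
  rw [h1, ← hv c c, ← hπ, re_inner_self_complex, re_inner_self_complex]
  have h2 : ‖π a (v c)‖ ≤ ‖a‖ * ‖v c‖ :=
    ((π a).le_opNorm _).trans (by gcongr; exact NonUnitalStarAlgHom.norm_apply_le π a)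
  calc ‖π a (v c)‖ ^ 2 ≤ (‖a‖ * ‖v c‖) ^ 2 := by gcongr
    _ = _ := by ring

theorem norm_apply_sq_le (hf : IsPosFun f) (a b : A) :
    ‖f (star a * b)‖ ^ 2 ≤ (f (star a * a)).re * (f (star b * b)).re := by
  obtain ⟨H, _, _, _, π, v, -, hπ, hv⟩ := hf.exists_gns
  rw [← hv, ← hv, ← hv, re_inner_self_complex, re_inner_self_complex]
  rw [← mul_pow]
  gcongr
  exact norm_inner_le_norm _ _

theorem star_mul_self_le (hf : IsPosFun f) (a : A) :
    (f (star a * a)).re ≤ ‖a‖ ^ 2 * (f 1).re := by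
  simpa using hf.conj_le a 1

theorem one_nonneg (hf : IsPosFun f) : 0 ≤ (f 1).re := by
  simpa using hf.re_nonneg 1

theorem norm_apply_le (hf : IsPosFun f) (a : A) : ‖f a‖ ≤ (f 1).re * ‖a‖ := by
  have h := hf.norm_apply_sq_le 1 a
  simp only [star_one, one_mul] at h
  refine (sq_le_sq₀ (norm_nonneg _) (mul_nonneg hf.one_nonneg (norm_nonneg _))).mp ?_
  calc _ ≤ _ := h
    _ ≤ (f 1).re * (‖a‖ ^ 2 * (f 1).re) := by
      gcongr
      · exact hf.one_nonneg
      · exact hf.star_mul_self_le a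
    _ = _ := by ring

theorem continuous (hf : IsPosFun f) : Continuous f :=
  (f.mkContinuous _ hf.norm_apply_le).continuous

theorem conj (hf : IsPosFun f) (c : A) :
    IsPosFun (f ∘ₗ LinearMap.mulLeft ℂ (star c) ∘ₗ LinearMap.mulRight ℂ c) := by
  intro a
  have := hf (a * c)
  simpa [mul_assoc] using this

theorem comp {B : Type v} [CStarAlgebra B] (hf : IsPosFun f) (φ : B →⋆ₐ[ℂ] A) :
    IsPosFun (f ∘ₗ φ.toAlgHom.toLinearMap) := by
  intro a
  have := hf (φ a)
  rwa [← StarHomClass.map_star, ← map_mul] at this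

end IsPosFun

/-- A functional is *norming* if the norm of the algebra is the operator norm in its GNS
representation. -/
def IsNorming {A : Type u} [CStarAlgebra A] (f : A →ₗ[ℂ] ℂ) : Prop :=
  ∀ (a : A) (M : ℝ), 0 ≤ M →
    (∀ c, (f (star c * (star a * a) * c)).re ≤ M * (f (star c * c)).re) → ‖a‖ ^ 2 ≤ M

theorem IsPosFun.isNorming_of_separating {A : Type u} [CStarAlgebra A] {f : A →ₗ[ℂ] ℂ}
    (hf : IsPosFun f) (h : ∀ a, (∀ c, f (star c * (star a * a) * c) = 0) → a = 0) :
    IsNorming f := by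
  intro a M hM hc
  obtain ⟨H, _, _, _, π, v, hd, hπ, hv⟩ := hf.exists_gns
  have hinj : Function.Injective π := by
    rw [injective_iff_map_eq_zero]
    intro b hb
    refine h b fun c => ?_
    have h1 : v (b * c) = 0 := by
      have := hπ b c
      rw [hb] at this
      simpa using this.symm
    have h2 := hv (b * c) (b * c)
    rw [h1, inner_zero_left] at h2
    rw [h2, star_mul]
    simp only [mul_assoc]
  rw [← NonUnitalStarAlgHom.norm_map π hinj]
  have h2 : ‖π a‖ ≤ √M := by
    refine ContinuousLinearMap.opNorm_le_bound _ (by positivity) fun x => ?_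
    refine hd.induction (P := fun x => ‖π a x‖ ≤ √M * ‖x‖) ?_
      (isClosed_le (by fun_prop) (by fun_prop)) x
    rintro _ ⟨c, rfl⟩
    refine (sq_le_sq₀ (by positivity) (by positivity)).mp ?_
    have h3 := hc c
    have h4 : f (star c * (star a * a) * c) = ⟪v (a * c), v (a * c)⟫_ℂ := by
      rw [hv]; simp [mul_assoc]
    rw [h4, ← hv c c, ← hπ, re_inner_self_complex, re_inner_self_complex] at h3
    rwa [mul_pow, Real.sq_sqrt hM]
  calc ‖π a‖ ^ 2 ≤ √M ^ 2 := by gcongr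
    _ = M := Real.sq_sqrt hM

theorem IsPosFun.isNorming_of_faithful {A : Type u} [CStarAlgebra A] {f : A →ₗ[ℂ] ℂ}
    (hf : IsPosFun f) (h : ∀ a, f (star a * a) = 0 → a = 0) : IsNorming f :=
  hf.isNorming_of_separating fun a ha => h a (by simpa using ha 1)

section Separation

variable {A : Type u} [CStarAlgebra A]

attribute [local instance] CStarAlgebra.spectralOrder CStarAlgebra.spectralOrderedRing

theorem nonneg_of_isPosFun {y : A} (hy : IsSelfAdjoint y)
    (h : ∀ ω : A →ₗ[ℂ] ℂ, IsPosFun ω → 0 ≤ (ω y).re) : 0 ≤ y := by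
  by_contra hneg
  have hcl : IsClosed {a : A | 0 ≤ a} := CStarAlgebra.isClosed_nonneg
  have hcv : Convex ℝ {a : A | 0 ≤ a} := by
    intro a ha b hb s t hs ht _
    exact add_nonneg (smul_nonneg hs (show (0 : A) ≤ a from ha))
      (smul_nonneg ht (show (0 : A) ≤ b from hb))
  obtain ⟨f, u, hfu, hf⟩ := geometric_hahn_banach_point_closed hcv hcl hneg
  have hu : u < 0 := by simpa using hf 0 (le_refl (0 : A))
  have hpos : ∀ b : A, 0 ≤ b → 0 ≤ f b := by
    intro b hb
    by_contra hb'
    push Not at hb'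
    have := hf ((u / f b) • b) (smul_nonneg (div_nonneg_of_nonpos hu.le hb'.le) hb :
      (0 : A) ≤ _)
    rw [map_smul, smul_eq_mul, div_mul_cancel₀ _ hb'.ne] at this
    exact lt_irrefl _ this
  let g : A →ₗ[ℝ] ℝ := f.toLinearMap ∘ₗ (selfAdjoint.submodule ℝ A).subtype ∘ₗ realPart
  have hg : ∀ a : A, IsSelfAdjoint a → g a = f a := fun a ha => by
    change f (realPart a : A) = f a
    rw [ha.coe_realPart]
  let ω : A →ₗ[ℂ] ℂ := Module.Dual.extendRCLike g
  have hω : IsPosFun ω := by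
    intro a
    rw [Complex.nonneg_iff]
    refine ⟨?_, ?_⟩
    · have : (ω (star a * a)).re = g (star a * a) :=
        Module.Dual.re_extendRCLike_apply (𝕜 := ℂ) g _
      rw [this, hg _ (.star_mul_self a)]
      exact hpos _ (star_mul_self_nonneg a)
    · have : (ω (star a * a)).im = - g (Complex.I • (star a * a)) :=
        Module.Dual.im_extendRCLike_apply (𝕜 := ℂ) g _
      rw [this]
      have : realPart (Complex.I • (star a * a)) = 0 := by
        rw [realPart_I_smul, (IsSelfAdjoint.star_mul_self a).imaginaryPart, neg_zero]
      change 0 = -f (realPart (Complex.I • (star a * a)) : A)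
      rw [this]; simp
  have h1 : (ω y).re = g y :=
        Module.Dual.re_extendRCLike_apply (𝕜 := ℂ) g _
  have h2 := h ω hω
  rw [h1, hg y hy] at h2
  linarith

theorem norm_le_of_isPosFun_of_isSelfAdjoint {y : A} (hy : IsSelfAdjoint y) {ε : ℝ} (hε : 0 ≤ ε)
    (h : ∀ ω : A →ₗ[ℂ] ℂ, IsPosFun ω → ‖ω y‖ ≤ ε * (ω 1).re) : ‖y‖ ≤ ε := by
  have hs : IsSelfAdjoint (algebraMap ℝ A ε) := .algebraMap _ (.all ε)
  have hval : ∀ ω : A →ₗ[ℂ] ℂ, (ω (algebraMap ℝ A ε)).re = ε * (ω 1).re := fun ω => by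
    rw [Algebra.algebraMap_eq_smul_one, LinearMap.map_smul_of_tower]; simp
  have hre : ∀ ω : A →ₗ[ℂ] ℂ, IsPosFun ω → |(ω y).re| ≤ ε * (ω 1).re := fun ω hω =>
    (Complex.abs_re_le_norm _).trans (h ω hω)
  have hle : y ≤ algebraMap ℝ A ε := by
    rw [← sub_nonneg]
    refine nonneg_of_isPosFun (hs.sub hy) fun ω hω => ?_
    have := abs_le.mp (hre ω hω)
    simp only [map_sub, Complex.sub_re, hval]
    linarith
  have hge : -y ≤ algebraMap ℝ A ε := by
    rw [← sub_nonneg]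
    refine nonneg_of_isPosFun (hs.sub hy.neg) fun ω hω => ?_
    have := abs_le.mp (hre ω hω)
    simp only [map_sub, map_neg, Complex.sub_re, Complex.neg_re, hval]
    linarith
  rcases subsingleton_or_nontrivial A with _ | _
  · rwa [Subsingleton.elim y 0, norm_zero]
  rcases CStarAlgebra.norm_or_neg_norm_mem_spectrum hy with h1 | h1
  · exact (le_algebraMap_iff_spectrum_le hy).mp hle _ h1
  · refine (le_algebraMap_iff_spectrum_le hy.neg).mp hge _ ?_
    rw [← spectrum.neg_eq]
    simpa using h1

theorem norm_le_of_isPosFun (y : A) {ε : ℝ} (hε : 0 ≤ ε)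
    (h : ∀ ω : A →ₗ[ℂ] ℂ, IsPosFun ω → ‖ω y‖ ≤ ε * (ω 1).re) : ‖y‖ ≤ 2 * ε := by
  have h1 : ‖(realPart y : A)‖ ≤ ε := by
    refine norm_le_of_isPosFun_of_isSelfAdjoint (realPart y).2 hε fun ω hω => ?_
    rw [realPart_apply_coe, LinearMap.map_smul_of_tower, map_add, hω.map_star, norm_smul]
    have := norm_add_le (ω y) (star (ω y))
    rw [norm_star] at this
    have := h ω hω
    simp only [norm_inv, Real.norm_ofNat]
    linarith
  have h2 : ‖(imaginaryPart y : A)‖ ≤ ε := by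
    refine norm_le_of_isPosFun_of_isSelfAdjoint (imaginaryPart y).2 hε fun ω hω => ?_
    rw [imaginaryPart_apply_coe, map_smul, LinearMap.map_smul_of_tower, map_sub, hω.map_star,
      norm_smul, norm_smul]
    have := norm_sub_le (ω y) (star (ω y))
    rw [norm_star] at this
    have := h ω hω
    simp only [norm_inv, norm_neg, Complex.norm_I, RCLike.norm_ofNat]
    linarith
  calc ‖y‖ = ‖(realPart y : A) + Complex.I • (imaginaryPart y : A)‖ := by
        rw [realPart_add_I_smul_imaginaryPart]
    _ ≤ _ := norm_add_le _ _
    _ ≤ 2 * ε := by rw [norm_smul, Complex.norm_I]; linarith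

end Separation

namespace IsPosFun

variable {A : Type u} [CStarAlgebra A] {f : A →ₗ[ℂ] ℂ}

theorem smul (hf : IsPosFun f) {c : ℝ} (hc : 0 ≤ c) : IsPosFun ((c : ℂ) • f) := fun a =>
  mul_nonneg (Complex.zero_le_real.mpr hc) (hf a)

theorem one_pos_of_ne_zero (hf : IsPosFun f) {a : A} (ha : f a ≠ 0) : 0 < (f 1).re := by
  refine lt_of_le_of_ne hf.one_nonneg fun h => ha ?_
  have := hf.norm_apply_le a
  rw [← h, zero_mul] at this
  exact norm_le_zero_iff.mp this

theorem eq_zero_of_star_mul_self (hf : IsPosFun f) {a : A} (ha : (f (star a * a)).re = 0) (b : A) :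
    f (star b * a) = 0 ∧ f (star a * b) = 0 := by
  have h1 := hf.norm_apply_sq_le b a
  have h2 := hf.norm_apply_sq_le a b
  rw [ha, mul_zero] at h1
  rw [ha, zero_mul] at h2
  constructor
  · simpa using h1.antisymm (sq_nonneg _)
  · simpa using h2.antisymm (sq_nonneg _)

theorem exists_almost_norming (d : A) :
    ∃ ω : A →ₗ[ℂ] ℂ, IsPosFun ω ∧ (ω 1).re ≤ 1 ∧ ‖d‖ ^ 2 / 2 ≤ (ω (star d * d)).re := by
  rcases eq_or_ne d 0 with rfl | hd
  · exact ⟨0, fun a => le_rfl, by simp, by simp⟩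
  have hd' : 0 < ‖d‖ := norm_pos_iff.mpr hd
  have : ∃ ω : A →ₗ[ℂ] ℂ, IsPosFun ω ∧ ‖d‖ ^ 2 / 2 * (ω 1).re < ‖ω (star d * d)‖ := by
    by_contra! h
    have := norm_le_of_isPosFun_of_isSelfAdjoint (.star_mul_self d) (by positivity) h
    rw [CStarRing.norm_star_mul_self] at this
    nlinarith
  obtain ⟨ω, hω, h⟩ := this
  have h0 : ‖ω (star d * d)‖ = (ω (star d * d)).re := by
    rw [← Complex.re_eq_norm.mpr (hω d)]
  have h1 : 0 < (ω 1).re := by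
    refine hω.one_pos_of_ne_zero (a := star d * d) fun h' => ?_
    rw [h', norm_zero] at h
    have := mul_nonneg (by positivity : 0 ≤ ‖d‖ ^ 2 / 2) hω.one_nonneg
    linarith
  refine ⟨(((ω 1).re⁻¹ : ℝ) : ℂ) • ω, hω.smul (by positivity), ?_, ?_⟩
  · rw [LinearMap.smul_apply, smul_eq_mul, Complex.re_ofReal_mul, inv_mul_cancel₀ h1.ne']
  · rw [LinearMap.smul_apply, smul_eq_mul, Complex.re_ofReal_mul, ← h0, inv_mul_eq_div,
      le_div_iff₀ h1]
    exact h.le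

theorem exists_faithful (A : Type u) [CStarAlgebra A] [TopologicalSpace.SeparableSpace A] :
    ∃ f : A →ₗ[ℂ] ℂ, IsPosFun f ∧ ∀ a, f (star a * a) = 0 → a = 0 := by
  obtain ⟨d, hd⟩ := TopologicalSpace.exists_dense_seq A
  choose ω hω h1 h2 using fun n => exists_almost_norming (d n)
  have hb : ∀ n a, ‖ω n a‖ ≤ ‖a‖ := fun n a => by
    refine ((hω n).norm_apply_le a).trans ?_
    exact mul_le_of_le_one_left (norm_nonneg _) (h1 n)
  have hs : ∀ a, Summable fun n => ((1 / 2 : ℝ) : ℂ) ^ n * ω n a := fun a => by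
    refine Summable.of_norm_bounded (summable_geometric_two.mul_right ‖a‖) fun n => ?_
    rw [norm_mul, norm_pow, Complex.norm_real, Real.norm_of_nonneg (by norm_num)]
    gcongr
    exact hb n a
  let f : A →ₗ[ℂ] ℂ :=
    { toFun := fun a => ∑' n, ((1 / 2 : ℝ) : ℂ) ^ n * ω n a
      map_add' := fun a b => by
        rw [← (hs a).tsum_add (hs b)]
        simp only [map_add, mul_add]
      map_smul' := fun c a => by
        rw [RingHom.id_apply, smul_eq_mul, ← tsum_mul_left]
        congr 1 with n
        simp only [map_smul, smul_eq_mul]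
        ring }
  have hnn : ∀ n a, 0 ≤ ((1 / 2 : ℝ) : ℂ) ^ n * ω n (star a * a) := fun n a =>
    mul_nonneg (pow_nonneg (Complex.zero_le_real.mpr (by norm_num)) n) (hω n a)
  refine ⟨f, fun a => tsum_nonneg fun n => hnn n a, fun a ha => ?_⟩
  have hz : ∀ n, (ω n (star a * a)).re = 0 := by
    have h3 := (hs (star a * a)).hasSum
    rw [show (∑' n, ((1 / 2 : ℝ) : ℂ) ^ n * ω n (star a * a)) = 0 from ha] at h3
    have h4 := Complex.hasSum_re h3
    rw [Complex.zero_re, hasSum_zero_iff_of_nonneg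
      (fun n => (Complex.nonneg_iff.mp (hnn n a)).1)] at h4
    intro n
    have h5 := congrFun h4 n
    simp only [← Complex.ofReal_pow, Complex.re_ofReal_mul, Pi.zero_apply] at h5
    exact (mul_eq_zero.mp h5).resolve_left (by positivity)
  have hle : ∀ n, ‖d n‖ ≤ 2 * ‖d n - a‖ := fun n => by
    have h3 := ((hω n).eq_zero_of_star_mul_self (hz n) (d n)).1
    have h4 : ω n (star (d n) * d n) = ω n (star (d n) * (d n - a)) := by
      rw [mul_sub, map_sub, h3, sub_zero]
    have h5 := h2 n
    rw [h4] at h5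
    have h6 := (Complex.re_le_norm _).trans (hb n (star (d n) * (d n - a)))
    have h7 := norm_mul_le (star (d n)) (d n - a)
    rw [norm_star] at h7
    rcases (norm_nonneg (d n)).eq_or_lt with h8 | h8
    · rw [← h8]; positivity
    · nlinarith
  have := hd.induction (P := fun x => ‖x‖ ≤ 2 * ‖x - a‖) (by rintro _ ⟨n, rfl⟩; exact hle n)
    (isClosed_le (by fun_prop) (by fun_prop)) a
  simpa using this

end IsPosFun

/-- Slicing by a farthest point: near any state, in a prescribed direction, there is a state which
is almost determined by the value of a single self-adjoint element. -/
theorem IsPosFun.exists_slice {A : Type u} [CStarAlgebra A] {ι : Type*} [Fintype ι] (x : ι → A)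
    (g : ι → ℂ) {ω₀ : A →ₗ[ℂ] ℂ} (hω₀ : IsPosFun ω₀) (h₀ : ω₀ 1 = 1) {ε : ℝ} (hε : 0 < ε) :
    ∃ (k : A →ₗ[ℂ] ℂ) (h : A) (u : ℝ), IsPosFun k ∧ k 1 = 1 ∧ IsSelfAdjoint h ∧ u < (k h).re ∧
      (∑ i, g i * ω₀ (x i)).re - ε ≤ (∑ i, g i * k (x i)).re ∧
      ∀ ω : A →ₗ[ℂ] ℂ, IsPosFun ω → ω 1 = 1 → u ≤ (ω h).re → ∀ i, ‖ω (x i) - k (x i)‖ ≤ ε := by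
  let X : (A →ₗ[ℂ] ℂ) → EuclideanSpace ℂ ι := fun ω => WithLp.toLp 2 fun i => ω (x i)
  let S : Set (A →ₗ[ℂ] ℂ) := {ω | IsPosFun ω ∧ ω 1 = 1}
  let B : ℝ := √(∑ i, ‖x i‖ ^ 2)
  have hB : ∀ ω ∈ S, ‖X ω‖ ≤ B := fun ω hω => by
    rw [EuclideanSpace.norm_eq]
    refine Real.sqrt_le_sqrt (Finset.sum_le_sum fun i _ => ?_)
    have := hω.1.norm_apply_le (x i)
    rw [hω.2, Complex.one_re, one_mul] at this
    gcongr
  let G : EuclideanSpace ℂ ι := WithLp.toLp 2 fun i => star (g i)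
  have hG : ∀ ω, ⟪G, X ω⟫_ℂ = ∑ i, g i * ω (x i) := fun ω => by
    simp [G, X, PiLp.inner_apply, mul_comm]
  let η : ℝ := ε ^ 2 / 3
  have hη : 0 < η := by positivity
  let R : ℝ := (η + (2 * B) ^ 2) / (2 * ε)
  have hR : 0 ≤ R := by positivity
  let p : EuclideanSpace ℂ ι := X ω₀ - (R : ℂ) • G
  have hbdd : BddAbove ((fun ω => ‖X ω - p‖ ^ 2) '' S) := by
    refine ⟨(B + ‖p‖) ^ 2, ?_⟩
    rintro _ ⟨ω, hω, rfl⟩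
    have := norm_sub_le (X ω) p
    have := hB ω hω
    change ‖X ω - p‖ ^ 2 ≤ _
    gcongr ?_ ^ 2
    linarith
  obtain ⟨_, ⟨k, hk, rfl⟩, hkS⟩ := exists_lt_of_lt_csSup (⟨_, ω₀, ⟨hω₀, h₀⟩, rfl⟩ :
    ((fun ω => ‖X ω - p‖ ^ 2) '' S).Nonempty) (sub_lt_self _ hη)
  have hmax : ∀ ω ∈ S, ‖X ω - p‖ ^ 2 ≤ ‖X k - p‖ ^ 2 + η := fun ω hω => by
    have := le_csSup hbdd (Set.mem_image_of_mem _ hω)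
    simp only at this hkS
    linarith
  let t : A := ∑ i, star ((X k - p) i) • x i
  have ht : ∀ ω : A →ₗ[ℂ] ℂ, ω t = ⟪X k - p, X ω⟫_ℂ := fun ω => by
    rw [PiLp.inner_apply, map_sum]
    exact Finset.sum_congr rfl fun i _ => by
      rw [map_smul, smul_eq_mul, RCLike.inner_apply, mul_comm]; rfl
  have hh : ∀ ω : A →ₗ[ℂ] ℂ, IsPosFun ω → (ω (realPart t : A)).re = (⟪X k - p, X ω⟫_ℂ).re := by
    intro ω hω
    rw [realPart_apply_coe, LinearMap.map_smul_of_tower, map_add, hω.map_star, ht]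
    rw [Complex.smul_re, Complex.add_re, ← starRingEnd_apply, Complex.conj_re,
      smul_eq_mul]
    ring
  refine ⟨k, realPart t, (k (realPart t : A)).re - η, hk.1, hk.2, (realPart t).2, by linarith,
    ?_, ?_⟩
  · have h1 := hmax ω₀ ⟨hω₀, h₀⟩
    have h2 : X k - p = (X k - X ω₀) + (R : ℂ) • G := by simp [p]; abel
    have h3 : X ω₀ - p = (R : ℂ) • G := by simp [p]
    rw [h2, h3, norm_add_sq (𝕜 := ℂ), inner_smul_right, ← inner_conj_symm, inner_sub_right,
      hG, hG] at h1
    have h4 : ‖X k - X ω₀‖ ≤ 2 * B := by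
      have := norm_sub_le (X k) (X ω₀)
      have := hB k hk
      have := hB ω₀ ⟨hω₀, h₀⟩
      linarith
    have h5 : ‖X k - X ω₀‖ ^ 2 ≤ (2 * B) ^ 2 := by gcongr
    simp only [RCLike.re_to_complex, Complex.re_ofReal_mul, Complex.conj_re, Complex.sub_re] at h1
    set a := (∑ i, g i * ω₀ (x i)).re
    set b := (∑ i, g i * k (x i)).re
    have h6 : R * (2 * ε) = η + (2 * B) ^ 2 := div_mul_cancel₀ _ (by positivity)
    by_contra! h7
    have h8 : 0 < R := by
      have : 0 ≤ (2 * B) ^ 2 := by positivity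
      nlinarith
    nlinarith
  · intro ω hω hω1 hu i
    rw [hh ω hω, hh k hk.1] at hu
    have h1 := hmax ω ⟨hω, hω1⟩
    have h2 : X ω - p = (X k - p) + (X ω - X k) := by abel
    rw [h2, norm_add_sq (𝕜 := ℂ), inner_sub_right] at h1
    simp only [RCLike.re_to_complex, Complex.sub_re] at h1
    have h3 : ‖X ω - X k‖ ^ 2 ≤ ε ^ 2 := by
      have : 3 * η = ε ^ 2 := by simp [η]; ring
      linarith
    have h4 := (sq_le_sq₀ (norm_nonneg _) hε.le).mp h3
    exact (PiLp.norm_apply_le (X ω - X k) i).trans h4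

section Excision

variable {A : Type u} [CStarAlgebra A]

attribute [local instance] CStarAlgebra.spectralOrder CStarAlgebra.spectralOrderedRing

theorem IsPosFun.re_nonneg_of_nonneg {ω : A →ₗ[ℂ] ℂ} (hω : IsPosFun ω) {a : A} (ha : 0 ≤ a) :
    0 ≤ (ω a).re := by
  obtain ⟨b, rfl⟩ := CStarAlgebra.nonneg_iff_eq_star_mul_self.mp ha
  exact hω.re_nonneg b

/-- Approximate excision of states. -/
theorem IsPosFun.exists_excision {ι : Type*} [Fintype ι] (x : ι → A)
    (g : ι → ℂ) {ω₀ : A →ₗ[ℂ] ℂ} (hω₀ : IsPosFun ω₀) (h₀ : ω₀ 1 = 1) {ε : ℝ} (hε : 0 < ε) :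
    ∃ (k : A →ₗ[ℂ] ℂ) (a : A), IsPosFun k ∧ k 1 = 1 ∧ IsSelfAdjoint a ∧ ‖a‖ = 1 ∧
      (∑ i, g i * ω₀ (x i)).re - ε ≤ (∑ i, g i * k (x i)).re ∧
      ∀ i, ‖a * x i * a - k (x i) • (a * a)‖ ≤ 2 * ε := by
  obtain ⟨k, h, u, hk, hk1, hh, hu, hg, hsl⟩ := hω₀.exists_slice x g h₀ hε
  have hs : IsSelfAdjoint (algebraMap ℝ A u) := .algebraMap _ (.all u)
  have hval : ∀ ω : A →ₗ[ℂ] ℂ, (ω (algebraMap ℝ A u)).re = u * (ω 1).re := fun ω => by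
    rw [Algebra.algebraMap_eq_smul_one, LinearMap.map_smul_of_tower]; simp
  set y := h - algebraMap ℝ A u with hy
  have hysa : IsSelfAdjoint y := hh.sub hs
  set b := y⁺ with hb
  have hb0 : 0 ≤ b := CFC.posPart_nonneg y
  have hbne : b ≠ 0 := by
    intro h0
    rw [hb, CFC.posPart_eq_zero_iff y hysa] at h0
    have := hk.re_nonneg_of_nonneg (neg_nonneg.mpr h0)
    rw [hy, map_neg, map_sub, Complex.neg_re, Complex.sub_re, hval, hk1, Complex.one_re] at this
    linarith
  have hbn : ‖b‖ ≠ 0 := norm_ne_zero_iff.mpr hbne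
  have hbsa : IsSelfAdjoint b := hb0.isSelfAdjoint
  have hby : 0 ≤ b * y * b := by
    have h1 : b * y * b = b * b * b := by
      conv_lhs => rw [← CFC.posPart_sub_negPart y hysa]
      rw [mul_sub, ← hb, hb, CFC.posPart_mul_negPart, sub_zero]
    rw [h1]
    exact hbsa.conjugate_nonneg hb0
  set a := ((‖b‖⁻¹ : ℝ)) • b with ha
  have hasa : IsSelfAdjoint a := (IsSelfAdjoint.all (‖b‖⁻¹ : ℝ)).smul hbsa
  have hay : 0 ≤ a * y * a := by
    rw [ha, smul_mul_assoc, smul_mul_assoc, mul_smul_comm]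
    exact smul_nonneg (by positivity) (smul_nonneg (by positivity) hby)
  have ha1 : ‖a‖ = 1 := by
    rw [ha, norm_smul, norm_inv, norm_norm, inv_mul_cancel₀ hbn]
  clear_value a
  refine ⟨k, a, hk, hk1, hasa, ha1, hg, fun i => norm_le_of_isPosFun _ hε.le fun ω hω => ?_⟩
  have hc := hω.conj a
  set c : ℝ := (ω (a * a)).re with hcdef
  have hcc : ω (a * a) = (c : ℂ) := by
    have := hω.im_eq_zero a
    rw [hasa.star_eq] at this
    exact Complex.ext rfl (by simpa using this)
  have hc0 : 0 ≤ c := by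
    have := hω.re_nonneg a
    rwa [hasa.star_eq] at this
  have hc1 : c ≤ (ω 1).re := by
    have := hω.star_mul_self_le a
    rwa [hasa.star_eq, ha1, one_pow, one_mul] at this
  have hconj : ∀ z, (ω ∘ₗ LinearMap.mulLeft ℂ (star a) ∘ₗ LinearMap.mulRight ℂ a) z =
      ω (a * z * a) := fun z => by simp [hasa.star_eq, mul_assoc]
  rw [map_sub, map_smul, hcc, smul_eq_mul]
  rcases hc0.eq_or_lt with h0 | hpos
  · have h1 := (hω.eq_zero_of_star_mul_self (a := a) (by rw [hasa.star_eq, hcc, ← h0]; rfl)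
      (star (a * x i))).1
    rw [star_star] at h1
    rw [h1, ← h0]
    simpa using mul_nonneg hε.le hω.one_nonneg
  · have h1 := hsl _ (hc.smul (inv_nonneg.mpr hc0)) ?_ ?_ i
    · rw [LinearMap.smul_apply, hconj, smul_eq_mul] at h1
      have h2 : ω (a * x i * a) - k (x i) * c =
          c * (((c⁻¹ : ℝ) : ℂ) * ω (a * x i * a) - k (x i)) := by
        have : (c : ℂ) ≠ 0 := by exact_mod_cast hpos.ne'
        push_cast
        field_simp
      rw [h2, norm_mul, Complex.norm_real, Real.norm_of_nonneg hc0, mul_comm]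
      gcongr
    · rw [LinearMap.smul_apply, hconj, mul_one, hcc, smul_eq_mul]
      push_cast
      exact inv_mul_cancel₀ (by exact_mod_cast hpos.ne')
    · rw [LinearMap.smul_apply, hconj, smul_eq_mul, Complex.re_ofReal_mul, inv_mul_eq_div,
        le_div_iff₀ hpos]
      have h2 := hω.re_nonneg_of_nonneg hay
      have h3 : a * y * a = a * h * a - u • (a * a) := by
        rw [hy, Algebra.algebraMap_eq_smul_one, mul_sub, sub_mul, mul_smul_comm, smul_mul_assoc,
          mul_one]
      rw [h3, map_sub, LinearMap.map_smul_of_tower, Complex.sub_re, Complex.smul_re,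
        smul_eq_mul] at h2
      linarith

end Excision

/-- The star homomorphism out of the algebraic tensor product determined by two commuting star
homomorphisms. -/
def tensorLift {A : Type u} {B : Type v} {Y : Type w} [CStarAlgebra A] [CStarAlgebra B]
    [CStarAlgebra Y] (i : A →⋆ₐ[ℂ] Y) (j : B →⋆ₐ[ℂ] Y) (hc : ∀ a b, Commute (i a) (j b)) :
    A ⊗[ℂ] B →⋆ₐ[ℂ] Y :=
  { Algebra.TensorProduct.lift i.toAlgHom j.toAlgHom hc with
    map_star' := fun x => by
      induction x with
      | zero => simp
      | add x y hx hy =>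
        simp only [AlgHom.toRingHom_eq_coe, RingHom.toMonoidHom_eq_coe, OneHom.toFun_eq_coe,
          MonoidHom.toOneHom_coe, MonoidHom.coe_coe, RingHom.coe_coe] at hx hy ⊢
        rw [star_add, map_add, map_add, star_add, hx, hy]
      | tmul a b =>
        change Algebra.TensorProduct.lift i.toAlgHom j.toAlgHom hc (star a ⊗ₜ star b) =
          star (i a * j b)
        rw [Algebra.TensorProduct.lift_tmul, star_mul, ← StarHomClass.map_star,
          ← StarHomClass.map_star]
        exact hc _ _ }

@[simp]
theorem tensorLift_tmul {A : Type u} {B : Type v} {Y : Type w} [CStarAlgebra A] [CStarAlgebra B]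
    [CStarAlgebra Y] (i : A →⋆ₐ[ℂ] Y) (j : B →⋆ₐ[ℂ] Y) (hc : ∀ a b, Commute (i a) (j b))
    (a : A) (b : B) : tensorLift i j hc (a ⊗ₜ b) = i a * j b := rfl

namespace CStarTensor

variable {A : Type u} {B : Type v} {T : Type w} [CStarAlgebra A] [CStarAlgebra B] [CStarAlgebra T]
  (h : CStarTensor A B T) (h1 : h.tmul 1 1 = 1)

theorem zero_tmul (b : B) : h.tmul 0 b = 0 := by
  simpa using h.smul_left 0 0 b

theorem tmul_zero (a : A) : h.tmul a 0 = 0 := by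
  simpa using h.smul_right 0 a 0

/-- The embedding `a ↦ a ⊗ 1`. -/
def left : A →⋆ₐ[ℂ] T where
  toFun a := h.tmul a 1
  map_one' := h1
  map_mul' a b := by rw [h.mul_tmul, one_mul]
  map_zero' := h.zero_tmul 1
  map_add' a b := h.add_left a b 1
  commutes' r := by
    rw [Algebra.algebraMap_eq_smul_one, Algebra.algebraMap_eq_smul_one, h.smul_left, h1]
  map_star' a := by rw [h.star_tmul, star_one]

/-- The embedding `b ↦ 1 ⊗ b`. -/
def right : B →⋆ₐ[ℂ] T where
  toFun b := h.tmul 1 b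
  map_one' := h1
  map_mul' a b := by rw [h.mul_tmul, one_mul]
  map_zero' := h.tmul_zero 1
  map_add' a b := h.add_right 1 a b
  commutes' r := by
    rw [Algebra.algebraMap_eq_smul_one, Algebra.algebraMap_eq_smul_one, h.smul_right, h1]
  map_star' a := by rw [h.star_tmul, star_one]

theorem left_apply (a : A) : h.left h1 a = h.tmul a 1 := rfl

theorem right_apply (b : B) : h.right h1 b = h.tmul 1 b := rfl

theorem commute_left_right (a : A) (b : B) : Commute (h.left h1 a) (h.right h1 b) := by
  rw [commute_iff_eq, left_apply, right_apply, h.mul_tmul, h.mul_tmul]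
  simp

/-- The canonical map from the algebraic tensor product. -/
def hom : A ⊗[ℂ] B →⋆ₐ[ℂ] T := tensorLift (h.left h1) (h.right h1) (h.commute_left_right h1)

@[simp]
theorem hom_tmul (a : A) (b : B) : h.hom h1 (a ⊗ₜ b) = h.tmul a b := by
  rw [hom, tensorLift_tmul, left_apply, right_apply, h.mul_tmul, mul_one, one_mul]

theorem denseRange_hom : DenseRange (h.hom h1) := by
  refine h.dense_span.mono ?_
  have : Submodule.span ℂ {t : T | ∃ a b, h.tmul a b = t} ≤
      LinearMap.range (h.hom h1).toAlgHom.toLinearMap := by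
    rw [Submodule.span_le]
    rintro _ ⟨a, b, rfl⟩
    exact ⟨a ⊗ₜ b, h.hom_tmul h1 a b⟩
  exact this

end CStarTensor

/-- Extension of a bounded positive functional from a dense star subalgebra. -/
theorem exists_isPosFun_extension {W : Type v} [Ring W] [StarRing W] [Algebra ℂ W] {X : Type u}
    [CStarAlgebra X] (ι : W →⋆ₐ[ℂ] X) (hι : DenseRange ι) (φ : W →ₗ[ℂ] ℂ)
    (hφ : ∀ w, 0 ≤ φ (star w * w)) {C : ℝ} (hC : ∀ w, ‖φ w‖ ≤ C * ‖ι w‖) :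
    ∃ χ : X →ₗ[ℂ] ℂ, IsPosFun χ ∧ ∀ w, χ (ι w) = φ w := by
  let χ : X →L[ℂ] ℂ := φ.extendOfNorm ι.toAlgHom.toLinearMap
  have hχ : ∀ w, χ (ι w) = φ w := LinearMap.extendOfNorm_eq (f := φ)
    (e := ι.toAlgHom.toLinearMap) hι ⟨C, hC⟩
  refine ⟨χ.toLinearMap, fun a => ?_, hχ⟩
  refine hι.induction (P := fun a => 0 ≤ χ (star a * a)) ?_
    (isClosed_le (by fun_prop) (by fun_prop)) a
  rintro _ ⟨w, rfl⟩
  rw [← StarHomClass.map_star, ← map_mul, hχ]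
  exact hφ w

/-- The algebraic tensor product of two functionals. -/
def tensorFun {A : Type u} {B : Type v} [CStarAlgebra A] [CStarAlgebra B]
    (l : A →ₗ[ℂ] ℂ) (m : B →ₗ[ℂ] ℂ) : A ⊗[ℂ] B →ₗ[ℂ] ℂ :=
  LinearMap.mul' ℂ ℂ ∘ₗ TensorProduct.map l m

@[simp]
theorem tensorFun_tmul {A : Type u} {B : Type v} [CStarAlgebra A] [CStarAlgebra B]
    (l : A →ₗ[ℂ] ℂ) (m : B →ₗ[ℂ] ℂ) (a : A) (b : B) : tensorFun l m (a ⊗ₜ b) = l a * m b := by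
  simp [tensorFun]

theorem tensorFun_star_mul_self_nonneg {A : Type u} {B : Type v} [CStarAlgebra A] [CStarAlgebra B]
    {l : A →ₗ[ℂ] ℂ} {m : B →ₗ[ℂ] ℂ} (hl : IsPosFun l) (hm : IsPosFun m) (z : A ⊗[ℂ] B) :
    0 ≤ tensorFun l m (star z * z) := by
  obtain ⟨H, _, _, _, -, p, -, -, hp⟩ := hl.exists_gns
  obtain ⟨K, _, _, _, -, q, -, -, hq⟩ := hm.exists_gns
  have key : ∀ z z' : A ⊗[ℂ] B, ⟪TensorProduct.map p q z, TensorProduct.map p q z'⟫_ℂ =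
      tensorFun l m (star z * z') := by
    intro z z'
    induction z with
    | zero => simp
    | add x y hx hy => rw [map_add, inner_add_left, hx, hy, star_add, add_mul, map_add]
    | tmul a b =>
      induction z' with
      | zero => simp
      | add x y hx hy => rw [map_add, inner_add_right, hx, hy, mul_add, map_add]
      | tmul c d => simp [hp, hq]
  rw [← key]
  have h1 := inner_self_eq_norm_sq_to_K (𝕜 := ℂ) (TensorProduct.map p q z)
  rw [h1]
  rw [RCLike.ofReal_eq_complex_ofReal, ← Complex.ofReal_pow]
  exact Complex.zero_le_real.mpr (sq_nonneg _)

namespace CStarTensor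

variable {A : Type u} {B : Type v} {T : Type w} [CStarAlgebra A] [CStarAlgebra B] [CStarAlgebra T]
  (h : CStarTensor A B T) (h1 : h.tmul 1 1 = 1)

theorem sub_tmul (a a' : A) (b : B) : h.tmul (a - a') b = h.tmul a b - h.tmul a' b := by
  have := h.add_left (a - a') a' b
  rw [sub_add_cancel] at this
  rw [this, add_sub_cancel_right]

theorem tmul_sub (a : A) (b b' : B) : h.tmul a (b - b') = h.tmul a b - h.tmul a b' := by
  have := h.add_right a (b - b') b'
  rw [sub_add_cancel] at this
  rw [this, add_sub_cancel_right]

theorem re_sum_state_le {ι : Type*} [Fintype ι] (x : ι → A) (y : ι → B) {l : A →ₗ[ℂ] ℂ}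
    {m : B →ₗ[ℂ] ℂ} (hl : IsPosFun l) (hm : IsPosFun m) (hl1 : l 1 = 1) (hm1 : m 1 = 1) :
    (∑ i, l (x i) * m (y i)).re ≤ ‖∑ i, h.tmul (x i) (y i)‖ := by
  let C : ℝ := ∑ i, (‖x i‖ + ‖y i‖)
  have hC : 0 ≤ C := Finset.sum_nonneg fun i _ => by positivity
  refine le_of_forall_pos_le_add fun δ hδ => ?_
  let ε : ℝ := δ / (2 * (C + 1))
  have hε : 0 < ε := by positivity
  have hεδ : 2 * ε * (C + 1) = δ := by
    simp only [ε]; field_simp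
  obtain ⟨k, a, hk, hk1, ha, ha1, hka, hax⟩ := hl.exists_excision x (fun i => m (y i)) hl1 hε
  obtain ⟨r, b, hr, hr1, hb, hb1, hrb, hby⟩ := hm.exists_excision y (fun i => k (x i)) hm1 hε
  have e1 : ∑ i, m (y i) * l (x i) = ∑ i, l (x i) * m (y i) := by simp only [mul_comm]
  have e2 : ∑ i, m (y i) * k (x i) = ∑ i, k (x i) * m (y i) := by simp only [mul_comm]
  rw [e1, e2] at hka
  set z := ∑ i, h.tmul (x i) (y i)
  set s := ∑ i, k (x i) * r (y i)
  have haa : ‖a * a‖ = 1 := by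
    have := CStarRing.norm_star_mul_self (x := a)
    rwa [ha.star_eq, ha1, mul_one] at this
  have hbb : ‖b * b‖ = 1 := by
    have := CStarRing.norm_star_mul_self (x := b)
    rwa [hb.star_eq, hb1, mul_one] at this
  have hkx : ∀ i, ‖k (x i)‖ ≤ ‖x i‖ := fun i => by simpa [hk1] using hk.norm_apply_le (x i)
  have hez : h.tmul a b * z * h.tmul a b = ∑ i, h.tmul (a * x i * a) (b * y i * b) := by
    simp only [z, Finset.mul_sum, Finset.sum_mul, h.mul_tmul]
  have hse : s • h.tmul (a * a) (b * b) =
      ∑ i, h.tmul (k (x i) • (a * a)) (r (y i) • (b * b)) := by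
    simp only [s, Finset.sum_smul, h.smul_left, h.smul_right, mul_smul]
  have hdiff : ‖s • h.tmul (a * a) (b * b) - h.tmul a b * z * h.tmul a b‖ ≤ 2 * ε * C := by
    rw [hez, hse, ← Finset.sum_sub_distrib, Finset.mul_sum]
    refine norm_sum_le_of_le _ fun i _ => ?_
    have hd : h.tmul (k (x i) • (a * a)) (r (y i) • (b * b)) -
        h.tmul (a * x i * a) (b * y i * b) =
        -(h.tmul (a * x i * a - k (x i) • (a * a)) (b * y i * b) +
          h.tmul (k (x i) • (a * a)) (b * y i * b - r (y i) • (b * b))) := by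
      rw [h.sub_tmul, h.tmul_sub]; abel
    rw [hd, norm_neg]
    refine (norm_add_le _ _).trans ?_
    rw [h.norm_tmul, h.norm_tmul, norm_smul, haa, mul_one]
    have h3 : ‖b * y i * b‖ ≤ ‖y i‖ := by
      refine (norm_mul_le _ _).trans ?_
      rw [hb1, mul_one]
      refine (norm_mul_le _ _).trans ?_
      rw [hb1, one_mul]
    calc _ ≤ 2 * ε * ‖y i‖ + ‖x i‖ * (2 * ε) := by
          gcongr
          · exact hax i
          · exact hkx i
          · exact hby i
      _ = _ := by ring
  have hab : ‖h.tmul a b‖ = 1 := by rw [h.norm_tmul, ha1, hb1, one_mul]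
  have h4 : ‖h.tmul a b * z * h.tmul a b‖ ≤ ‖z‖ := by
    refine (norm_mul_le _ _).trans ?_
    rw [hab, mul_one]
    refine (norm_mul_le _ _).trans ?_
    rw [hab, one_mul]
  have h5 : ‖s‖ ≤ ‖z‖ + 2 * ε * C := by
    have : ‖s • h.tmul (a * a) (b * b)‖ = ‖s‖ := by
      rw [norm_smul, h.norm_tmul, haa, hbb, mul_one, mul_one]
    rw [← this]
    have := norm_sub_norm_le (s • h.tmul (a * a) (b * b)) (h.tmul a b * z * h.tmul a b)
    linarith
  have h6 := Complex.re_le_norm s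
  linarith

theorem norm_tensorFun_state_le {l : A →ₗ[ℂ] ℂ} {m : B →ₗ[ℂ] ℂ} (hl : IsPosFun l)
    (hm : IsPosFun m) (hl1 : l 1 = 1) (hm1 : m 1 = 1) (z : A ⊗[ℂ] B) :
    ‖tensorFun l m z‖ ≤ ‖h.hom h1 z‖ := by
  have hre : ∀ z : A ⊗[ℂ] B, (tensorFun l m z).re ≤ ‖h.hom h1 z‖ := fun z => by
    obtain ⟨S, rfl⟩ := TensorProduct.exists_finset z
    have := h.re_sum_state_le (fun i : S => i.1.1) (fun i : S => i.1.2) hl hm hl1 hm1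
    rw [Finset.sum_coe_sort S (fun i => l i.1 * m i.2),
      Finset.sum_coe_sort S (fun i => h.tmul i.1 i.2)] at this
    simpa only [map_sum, tensorFun_tmul, hom_tmul] using this
  obtain ⟨c, hc, hcz⟩ : ∃ c : ℂ, ‖c‖ = 1 ∧ c * tensorFun l m z = ‖tensorFun l m z‖ := by
    obtain ⟨c, hc, h⟩ := RCLike.exists_norm_eq_mul_self (tensorFun l m z)
    exact ⟨c, hc, h.symm⟩
  have := hre (c • z)
  rw [map_smul, map_smul, smul_eq_mul, hcz, norm_smul, hc, one_mul] at this
  simpa using this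

theorem _root_.IsPosFun.exists_state {f : A →ₗ[ℂ] ℂ} (hf : IsPosFun f) (hne : f ≠ 0) :
    ∃ g : A →ₗ[ℂ] ℂ, IsPosFun g ∧ g 1 = 1 ∧ f = (((f 1).re : ℝ) : ℂ) • g := by
  have h1 : 0 < (f 1).re := by
    by_contra h
    refine hne (LinearMap.ext fun a => ?_)
    by_contra ha
    exact h (hf.one_pos_of_ne_zero ha)
  have h2 : f 1 = (((f 1).re : ℝ) : ℂ) := by
    have := hf.im_eq_zero 1
    rw [star_one, mul_one] at this
    exact Complex.ext rfl (by simpa using this)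
  have h3 : (((f 1).re : ℝ) : ℂ) ≠ 0 := by exact_mod_cast h1.ne'
  refine ⟨(((f 1).re⁻¹ : ℝ) : ℂ) • f, hf.smul (by positivity), ?_, ?_⟩
  · rw [LinearMap.smul_apply, smul_eq_mul, Complex.ofReal_inv, ← h2]
    rw [← h2] at h3
    exact inv_mul_cancel₀ h3
  · rw [Complex.ofReal_inv, smul_inv_smul₀ h3]

/-- Product functionals are bounded for every C*-norm on the algebraic tensor product. -/
theorem exists_norm_tensorFun_le {l : A →ₗ[ℂ] ℂ} {m : B →ₗ[ℂ] ℂ} (hl : IsPosFun l)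
    (hm : IsPosFun m) : ∃ C : ℝ, ∀ z, ‖tensorFun l m z‖ ≤ C * ‖h.hom h1 z‖ := by
  by_cases hl0 : l = 0
  · exact ⟨0, fun z => by simp [hl0, tensorFun]⟩
  by_cases hm0 : m = 0
  · exact ⟨0, fun z => by simp [hm0, tensorFun]⟩
  obtain ⟨l', hl', hl1, hll⟩ := hl.exists_state hl0
  obtain ⟨m', hm', hm1, hmm⟩ := hm.exists_state hm0
  set c : ℂ := (((l 1).re : ℝ) : ℂ)
  set d : ℂ := (((m 1).re : ℝ) : ℂ)
  refine ⟨‖c * d‖, fun z => ?_⟩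
  have : tensorFun l m z = (c * d) • tensorFun l' m' z := by
    rw [hll, hmm, tensorFun, TensorProduct.map_smul_left, TensorProduct.map_smul_right]
    simp [tensorFun, mul_assoc]
  rw [this, norm_smul]
  gcongr
  exact h.norm_tensorFun_state_le h1 hl' hm' hl1 hm1 z

/-- Product functionals extend to any C*-tensor product. -/
theorem exists_prod (h1 : h.tmul 1 1 = 1) {l : A →ₗ[ℂ] ℂ} {m : B →ₗ[ℂ] ℂ} (hl : IsPosFun l)
    (hm : IsPosFun m) :
    ∃ χ : T →ₗ[ℂ] ℂ, IsPosFun χ ∧ ∀ a b, χ (h.tmul a b) = l a * m b := by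
  obtain ⟨C, hC⟩ := h.exists_norm_tensorFun_le h1 hl hm
  obtain ⟨χ, hχ, he⟩ := exists_isPosFun_extension (h.hom h1) (h.denseRange_hom h1)
    (tensorFun l m) (tensorFun_star_mul_self_nonneg hl hm) hC
  refine ⟨χ, hχ, fun a b => ?_⟩
  rw [← hom_tmul h h1, he, tensorFun_tmul]

end CStarTensor

open scoped CStarAlgebra

theorem CStarTensor.eq_of_forall_tmul {A : Type u} {B : Type v} {T : Type w} [CStarAlgebra A]
    [CStarAlgebra B] [CStarAlgebra T] (h : CStarTensor A B T) {Y F G : Type*}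
    [NormedAddCommGroup Y] [NormedSpace ℂ Y] [FunLike F T Y] [ContinuousLinearMapClass F ℂ T Y]
    [FunLike G T Y] [ContinuousLinearMapClass G ℂ T Y] (f : F) (g : G)
    (hfg : ∀ a b, f (h.tmul a b) = g (h.tmul a b)) (t : T) : f t = g t := by
  refine h.dense_span.induction (P := fun t => f t = g t) (fun t ht => ?_)
    (isClosed_eq (map_continuous f) (map_continuous g)) t
  induction ht using Submodule.span_induction with
  | mem x hx => obtain ⟨a, b, rfl⟩ := hx; exact hfg a b
  | zero => rw [map_zero, map_zero]
  | add x y _ _ hx hy => rw [map_add, map_add, hx, hy]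
  | smul c x _ hx => rw [map_smul, map_smul, hx]

theorem exists_starAlgHom_extension {W : Type v} [Ring W] [StarRing W] [Algebra ℂ W] {X : Type u}
    [CStarAlgebra X] {Y : Type w} [CStarAlgebra Y] (ι : W →⋆ₐ[ℂ] X) (hι : DenseRange ι)
    (R : W →⋆ₐ[ℂ] Y) (hR : ∀ w, ‖R w‖ ≤ ‖ι w‖) : ∃ F : X →⋆ₐ[ℂ] Y, ∀ w, F (ι w) = R w := by
  let F : X →L[ℂ] Y := R.toAlgHom.toLinearMap.extendOfNorm ι.toAlgHom.toLinearMap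
  have hF : ∀ w, F (ι w) = R w := LinearMap.extendOfNorm_eq (f := R.toAlgHom.toLinearMap)
    (e := ι.toAlgHom.toLinearMap) hι ⟨1, fun w => by rw [one_mul]; exact hR w⟩
  have h1 : F 1 = 1 := by rw [← map_one ι, hF, map_one]
  refine ⟨{ toFun := F, map_one' := h1, map_mul' := fun x y => ?_, map_zero' := map_zero F,
            map_add' := map_add F, commutes' := fun r => ?_, map_star' := fun x => ?_ }, hF⟩
  · refine hι.induction (P := fun x => F (x * y) = F x * F y) ?_
      (isClosed_eq (by fun_prop) (by fun_prop)) x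
    rintro _ ⟨w, rfl⟩
    refine hι.induction (P := fun y => F (ι w * y) = F (ι w) * F y) ?_
      (isClosed_eq (by fun_prop) (by fun_prop)) y
    rintro _ ⟨w', rfl⟩
    rw [← map_mul, hF, hF, hF, map_mul]
  · change F (algebraMap ℂ X r) = _
    rw [Algebra.algebraMap_eq_smul_one, Algebra.algebraMap_eq_smul_one, map_smul, h1]
  · refine hι.induction (P := fun x => F (star x) = star (F x)) ?_
      (isClosed_eq (by fun_prop) (by fun_prop)) x
    rintro _ ⟨w, rfl⟩
    rw [← StarHomClass.map_star, hF, hF, StarHomClass.map_star]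

/-- A star homomorphism on a dense star subalgebra extends as soon as enough vector functionals of
a norming functional pull back to bounded functionals. -/
theorem IsNorming.exists_extension {W : Type v} [Ring W] [StarRing W] [Algebra ℂ W] {X : Type u}
    [CStarAlgebra X] {Y : Type w} [CStarAlgebra Y] {χ : Y →ₗ[ℂ] ℂ} (hn : IsNorming χ)
    (hχ : IsPosFun χ) (ι : W →⋆ₐ[ℂ] X) (hι : DenseRange ι) (R : W →⋆ₐ[ℂ] Y) {S : Set Y}
    (hS : Dense S) (hb : ∀ c ∈ S, ∃ M : ℝ, ∀ w, ‖χ (star c * R w * c)‖ ≤ M * ‖ι w‖) :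
    ∃ F : X →⋆ₐ[ℂ] Y, ∀ w, F (ι w) = R w := by
  refine exists_starAlgHom_extension ι hι R fun w => ?_
  refine (sq_le_sq₀ (norm_nonneg _) (norm_nonneg _)).mp (hn _ _ (sq_nonneg _) fun c => ?_)
  have hcont := hχ.continuous
  refine hS.induction (P := fun c => (χ (star c * (star (R w) * R w) * c)).re ≤
    ‖ι w‖ ^ 2 * (χ (star c * c)).re) (fun c hc => ?_)
    (isClosed_le (by fun_prop) (by fun_prop)) c
  obtain ⟨M, hM⟩ := hb c hc
  let φ : W →ₗ[ℂ] ℂ := χ ∘ₗ LinearMap.mulRight ℂ c ∘ₗ LinearMap.mulLeft ℂ (star c) ∘ₗ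
    R.toAlgHom.toLinearMap
  have hφ : ∀ w, φ w = χ (star c * R w * c) := fun w => rfl
  have hpos : ∀ w, 0 ≤ φ (star w * w) := fun w => by
    have := hχ (R w * c)
    rwa [star_mul, ← mul_assoc, mul_assoc (star c), ← StarHomClass.map_star, ← map_mul R,
      ← hφ] at this
  obtain ⟨ψ, hψ, hψe⟩ := exists_isPosFun_extension ι hι φ hpos hM
  have := hψ.star_mul_self_le (ι w)
  rw [← map_one ι, ← StarHomClass.map_star, ← map_mul, hψe, hψe, hφ, hφ, map_one R, mul_one,
    map_mul R, StarHomClass.map_star R] at this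
  exact this

/-- On the minimal tensor product, a product of norming functionals is norming. -/
theorem MinTensor.isNorming {A B T : Type u} [CStarAlgebra A] [CStarAlgebra B] [CStarAlgebra T]
    (h : MinTensor A B T) {l : A →ₗ[ℂ] ℂ} {m : B →ₗ[ℂ] ℂ} {χ : T →ₗ[ℂ] ℂ} (hχ : IsPosFun χ)
    (hlm : ∀ a b, χ (h.tmul a b) = l a * m b) (hl : IsPosFun l) (hm : IsPosFun m)
    (hln : IsNorming l) (hmn : IsNorming m) : IsNorming χ := by
  refine hχ.isNorming_of_separating fun t ht => ?_
  obtain ⟨H, _, _, _, π, v, hd, hπ, hv⟩ := hχ.exists_gns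
  have hvn : ∀ x, ‖v x‖ ^ 2 = (χ (star x * x)).re := fun x => by
    rw [← hv, re_inner_self_complex]
  have hre : ∀ {C : Type u} [CStarAlgebra C] {f : C →ₗ[ℂ] ℂ}, IsPosFun f → ∀ c,
      f (star c * c) = (((f (star c * c)).re : ℝ) : ℂ) := fun hf c =>
    Complex.ext rfl (by simpa using hf.im_eq_zero c)
  have hvt : ∀ a b, ‖v (h.tmul a b)‖ ^ 2 = (l (star a * a)).re * (m (star b * b)).re := by
    intro a b
    rw [hvn, h.star_tmul, h.mul_tmul, hlm, hre hl, hre hm, ← Complex.ofReal_mul,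
      Complex.ofReal_re, Complex.ofReal_re, Complex.ofReal_re]
  have hnorm : ∀ a b, ‖π (h.tmul a b)‖ = ‖a‖ * ‖b‖ := by
    intro a b
    refine le_antisymm ((NonUnitalStarAlgHom.norm_apply_le π _).trans_eq (h.norm_tmul a b)) ?_
    set K := ‖π (h.tmul a b)‖
    have hK : 0 ≤ K := norm_nonneg _
    have h1 : ∀ c d, (l (star c * (star a * a) * c)).re * (m (star d * (star b * b) * d)).re ≤
        K ^ 2 * ((l (star c * c)).re * (m (star d * d)).re) := by
      intro c d
      have h2 := (π (h.tmul a b)).le_opNorm (v (h.tmul c d))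
      rw [hπ, h.mul_tmul] at h2
      have h3 := pow_le_pow_left₀ (norm_nonneg _) h2 2
      rw [mul_pow, hvt, hvt] at h3
      simpa only [star_mul, mul_assoc] using h3
    have hnn : ∀ {C : Type u} [CStarAlgebra C] {f : C →ₗ[ℂ] ℂ}, IsPosFun f → ∀ c a : C,
        0 ≤ (f (star c * (star a * a) * c)).re := fun hf c a => by
      simpa only [star_mul, mul_assoc] using hf.re_nonneg (a * c)
    have h2 : ∀ d, ‖a‖ ^ 2 * (m (star d * (star b * b) * d)).re ≤
        K ^ 2 * (m (star d * d)).re := by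
      intro d
      have hr := hm.re_nonneg d
      rcases (hnn hm d b).eq_or_lt with hs | hs
      · rw [← hs, mul_zero]; positivity
      · rw [← le_div_iff₀ hs]
        refine hln a _ (by positivity) fun c => ?_
        rw [div_mul_eq_mul_div, le_div_iff₀ hs]
        linarith [h1 c d]
    refine (sq_le_sq₀ (by positivity) hK).mp ?_
    rw [mul_pow]
    rcases (sq_nonneg ‖a‖).eq_or_lt with ha | ha
    · rw [← ha, zero_mul]; positivity
    · rw [mul_comm, ← le_div_iff₀ ha]
      refine hmn b _ (by positivity) fun d => ?_
      rw [div_mul_eq_mul_div, le_div_iff₀ ha]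
      linarith [h2 d]
  let S : StarSubalgebra ℂ (H →L[ℂ] H) := π.range.topologicalClosure
  have hScl : IsClosed (S : Set (H →L[ℂ] H)) := StarSubalgebra.isClosed_topologicalClosure _
  let _ : CStarAlgebra S := StarSubalgebra.cstarAlgebra S
  let ρ : T →⋆ₐ[ℂ] S := π.codRestrict S fun x =>
    StarSubalgebra.le_topologicalClosure _ ⟨x, rfl⟩
  have hρn : ∀ t, ‖ρ t‖ = ‖π t‖ := fun t => rfl
  have hρd : DenseRange ρ := by
    rintro ⟨s, hs⟩
    rw [closure_subtype, ← Set.range_comp]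
    exact hs
  let h' : CStarTensor A B S :=
    { tmul := fun a b => ρ (h.tmul a b)
      add_left := fun a a' b => by rw [h.add_left, map_add]
      add_right := fun a a' b => by rw [h.add_right, map_add]
      smul_left := fun c a b => by rw [h.smul_left, map_smul]
      smul_right := fun c a b => by rw [h.smul_right, map_smul]
      mul_tmul := fun a a' b b' => by rw [← map_mul, h.mul_tmul]
      star_tmul := fun a b => by rw [← StarHomClass.map_star, h.star_tmul]
      norm_tmul := fun a b => by rw [hρn, hnorm]
      dense_span := by
        refine (hρd.dense_image (map_continuous ρ) h.dense_span).mono ?_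
        have : (Submodule.span ℂ {t : T | ∃ a b, h.tmul a b = t}).map
            ρ.toAlgHom.toLinearMap ≤
            Submodule.span ℂ {t : S | ∃ a b, ρ (h.tmul a b) = t} := by
          rw [Submodule.map_span_le]
          rintro _ ⟨a, b, rfl⟩
          exact Submodule.subset_span ⟨a, b, rfl⟩
        exact this }
  obtain ⟨κ, hκ⟩ := h.minimal S h'
  have hκρ : ∀ t, κ (ρ t) = t := by
    refine h.eq_of_forall_tmul (κ.comp (ρ : T →⋆ₙₐ[ℂ] S)) (NonUnitalStarAlgHom.id ℂ T) ?_
    exact hκ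
  have hπt : π t = 0 := by
    refine ContinuousLinearMap.ext fun x => ?_
    refine hd.induction (P := fun x => π t x = 0) ?_
      (isClosed_eq (by fun_prop) (by fun_prop)) x
    rintro _ ⟨c, rfl⟩
    have := hvn (t * c)
    rw [star_mul, ← mul_assoc, mul_assoc (star c), ht, Complex.zero_re] at this
    rw [hπ]
    simpa using this
  have h0 : ρ t = 0 := Subtype.ext hπt
  rw [← hκρ t, h0, map_zero]

namespace CStarTensor

variable {A : Type u} {B : Type v} {T : Type w} [CStarAlgebra A] [CStarAlgebra B] [CStarAlgebra T]
  (h : CStarTensor A B T)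

/-- The map `a ↦ a ⊗ b`. -/
def tmulRight (b : B) : A →L[ℂ] T :=
  LinearMap.mkContinuous
    { toFun := fun a => h.tmul a b
      map_add' := fun a a' => h.add_left a a' b
      map_smul' := fun c a => h.smul_left c a b } ‖b‖
    fun a => by rw [mul_comm]; exact (h.norm_tmul a b).le

/-- The map `b ↦ a ⊗ b`. -/
def tmulLeft (a : A) : B →L[ℂ] T :=
  LinearMap.mkContinuous
    { toFun := fun b => h.tmul a b
      map_add' := fun b b' => h.add_right a b b'
      map_smul' := fun c b => h.smul_right c a b } ‖a‖
    fun b => (h.norm_tmul a b).le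

theorem dense_span_image2 {G : Set A} {G' : Set B}
    (hG : Dense (Submodule.span ℂ G : Set A)) (hG' : Dense (Submodule.span ℂ G' : Set B)) :
    Dense (Submodule.span ℂ (Set.image2 h.tmul G G') : Set T) := by
  set K := (Submodule.span ℂ (Set.image2 h.tmul G G')).topologicalClosure
  have hK : IsClosed (K : Set T) := Submodule.isClosed_topologicalClosure _
  have h1 : ∀ a, ∀ b ∈ G', h.tmul a b ∈ K := fun a b hb =>
    hG.induction (P := fun a => h.tmulRight b a ∈ K)
      (fun a ha => (Submodule.span_le (p := K.comap (h.tmulRight b).toLinearMap)).mpr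
        (fun a ha => Submodule.le_topologicalClosure _ (Submodule.subset_span ⟨a, ha, b, hb, rfl⟩))
        ha)
      (hK.preimage (h.tmulRight b).continuous) a
  have h2 : ∀ a b, h.tmul a b ∈ K := fun a b =>
    hG'.induction (P := fun b => h.tmulLeft a b ∈ K)
      (fun b hb => (Submodule.span_le (p := K.comap (h.tmulLeft a).toLinearMap)).mpr
        (fun b hb => h1 a b hb) hb)
      (hK.preimage (h.tmulLeft a).continuous) b
  have h3 : Submodule.span ℂ {t : T | ∃ a b, h.tmul a b = t} ≤ K :=
    Submodule.span_le.mpr (by rintro _ ⟨a, b, rfl⟩; exact h2 a b)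
  have h4 : Dense (K : Set T) := h.dense_span.mono h3
  rw [Submodule.topologicalClosure_coe] at h4
  exact dense_closure.mp h4

end CStarTensor

/-- A star homomorphism `f : A → P` induces a map `A ⊗ A → P ⊗ P` as soon as enough vector
functionals of a norming product functional pull back along `f` to vector functionals. -/
theorem exists_tensor_self_map {A TA P PP : Type u} [CStarAlgebra A] [CStarAlgebra TA]
    [CStarAlgebra P] [CStarAlgebra PP] (hA : CStarTensor A A TA) (hA1 : hA.tmul 1 1 = 1)
    (hP : CStarTensor P P PP) (hP1 : hP.tmul 1 1 = 1) (f : A →⋆ₐ[ℂ] P)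
    {l : A →ₗ[ℂ] ℂ} (hl : IsPosFun l) {m : P →ₗ[ℂ] ℂ} {χ : PP →ₗ[ℂ] ℂ} (hχ : IsPosFun χ)
    (hn : IsNorming χ) (hχm : ∀ p q, χ (hP.tmul p q) = m p * m q) {G : Set P}
    (hG : Dense (Submodule.span ℂ G : Set P))
    (hf : ∀ p ∈ G, ∀ q ∈ G, ∃ r s : A, ∀ x, m (star p * f x * q) = l (star r * x * s)) :
    ∃ i : TA →⋆ₐ[ℂ] PP, ∀ a b, i (hA.tmul a b) = hP.tmul (f a) (f b) := by
  obtain ⟨L, hL, hLl⟩ := hA.exists_prod hA1 hl hl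
  let R : A ⊗[ℂ] A →⋆ₐ[ℂ] PP := tensorLift ((hP.left hP1).comp f) ((hP.right hP1).comp f)
    fun a b => hP.commute_left_right hP1 (f a) (f b)
  have hR : ∀ a b, R (a ⊗ₜ b) = hP.tmul (f a) (f b) := fun a b => by
    change hP.tmul (f a) 1 * hP.tmul 1 (f b) = _
    rw [hP.mul_tmul, mul_one, one_mul]
  have h0 : ∀ c ∈ Set.image2 hP.tmul G G, ∀ c' ∈ Set.image2 hP.tmul G G,
      ∃ M : ℝ, ∀ w, ‖χ (star c * R w * c')‖ ≤ M * ‖hA.hom hA1 w‖ := by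
    rintro _ ⟨p, hp, q, hq, rfl⟩ _ ⟨p', hp', q', hq', rfl⟩
    obtain ⟨r, s, hrs⟩ := hf p hp p' hp'
    obtain ⟨r', s', hrs'⟩ := hf q hq q' hq'
    have key : ∀ w, χ (star (hP.tmul p q) * R w * hP.tmul p' q') =
        L (star (hA.tmul r r') * hA.hom hA1 w * hA.tmul s s') := by
      intro w
      induction w with
      | zero => simp
      | add x y hx hy =>
        rw [map_add, mul_add, add_mul, map_add, map_add, mul_add, add_mul, map_add, hx, hy]
      | tmul a b =>
        rw [hR, hP.star_tmul, hP.mul_tmul, hP.mul_tmul, hχm, hrs, hrs', hA.hom_tmul, hA.star_tmul,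
          hA.mul_tmul, hA.mul_tmul, hLl]
    refine ⟨(L 1).re * (‖star (hA.tmul r r')‖ * ‖hA.tmul s s'‖), fun w => ?_⟩
    rw [key]
    calc _ ≤ (L 1).re * ‖star (hA.tmul r r') * hA.hom hA1 w * hA.tmul s s'‖ := by
          have := hL.norm_apply_le (star (hA.tmul r r') * hA.hom hA1 w * hA.tmul s s')
          linarith
      _ ≤ (L 1).re * (‖star (hA.tmul r r')‖ * ‖hA.hom hA1 w‖ * ‖hA.tmul s s'‖) := by
          gcongr
          · exact hL.one_nonneg
          · exact (norm_mul_le _ _).trans (by gcongr; exact norm_mul_le _ _)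
      _ = _ := by ring
  have h1 : ∀ c ∈ Submodule.span ℂ (Set.image2 hP.tmul G G),
      ∀ c' ∈ Submodule.span ℂ (Set.image2 hP.tmul G G),
      ∃ M : ℝ, ∀ w, ‖χ (star c * R w * c')‖ ≤ M * ‖hA.hom hA1 w‖ := by
    intro c hc c' hc'
    induction hc, hc' using Submodule.span_induction₂ with
    | mem_mem x y hx hy => exact h0 x hx y hy
    | zero_left y hy => exact ⟨0, fun w => by simp⟩
    | zero_right x hx => exact ⟨0, fun w => by simp⟩
    | add_left x y z hx hy hz h h' =>
      obtain ⟨M, hM⟩ := h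
      obtain ⟨N, hN⟩ := h'
      refine ⟨M + N, fun w => ?_⟩
      rw [star_add, add_mul, add_mul, map_add, add_mul]
      exact norm_add_le_of_le (hM w) (hN w)
    | add_right x y z hx hy hz h h' =>
      obtain ⟨M, hM⟩ := h
      obtain ⟨N, hN⟩ := h'
      refine ⟨M + N, fun w => ?_⟩
      rw [mul_add, map_add, add_mul]
      exact norm_add_le_of_le (hM w) (hN w)
    | smul_left r x y hx hy h =>
      obtain ⟨M, hM⟩ := h
      refine ⟨‖r‖ * M, fun w => ?_⟩
      rw [star_smul, smul_mul_assoc, smul_mul_assoc, map_smul, norm_smul, norm_star,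
        mul_assoc ‖r‖ M]
      exact mul_le_mul_of_nonneg_left (hM w) (norm_nonneg r)
    | smul_right r x y hx hy h =>
      obtain ⟨M, hM⟩ := h
      refine ⟨‖r‖ * M, fun w => ?_⟩
      rw [mul_smul_comm, map_smul, norm_smul, mul_assoc ‖r‖ M]
      exact mul_le_mul_of_nonneg_left (hM w) (norm_nonneg r)
  obtain ⟨i, hi⟩ := hn.exists_extension hχ (hA.hom hA1) (hA.denseRange_hom hA1) R
    (hP.dense_span_image2 hG hG) fun c hc => h1 c hc c hc
  exact ⟨i, fun a b => by rw [← hR, ← hi, hA.hom_tmul]⟩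

/-- In a unital algebra the unitaries in an approximate unitary equivalence may be taken in the
algebra itself. -/
theorem approxUnitaryEquiv_iff {A : Type u} {B : Type v} [CStarAlgebra B] {φ ψ : A → B} :
    ApproxUnitaryEquiv φ ψ ↔ ∃ v : ℕ → B, (∀ n, v n ∈ unitary B) ∧
      ∀ a, Tendsto (fun n => star (v n) * φ a * v n) atTop (𝓝 (ψ a)) := by
  let c : B →⋆ₙₐ[ℂ] 𝓜(ℂ, B) := DoubleCentralizer.coeHom
  have hc1 : c 1 = 1 := DoubleCentralizer.ext _ _ _ _ <| Prod.ext
    (ContinuousLinearMap.ext fun x => one_mul x) (ContinuousLinearMap.ext fun x => mul_one x)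
  have hinj : Function.Injective c := fun a b hab => by
    have : (c a).fst 1 = (c b).fst 1 := by rw [hab]
    simpa [c, DoubleCentralizer.coeHom] using this
  have hnorm : ∀ b, ‖c b‖ = ‖b‖ := NonUnitalStarAlgHom.norm_map c hinj
  have hsurj : Function.Surjective c := fun m => by
    have h1 : ∀ x y, m.snd x * y = x * m.fst y := m.central
    refine ⟨m.fst 1, DoubleCentralizer.ext _ _ _ _ <| Prod.ext
      (ContinuousLinearMap.ext fun x => ?_) (ContinuousLinearMap.ext fun x => ?_)⟩
    · change m.fst 1 * x = m.fst x
      have h2 := h1 1 x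
      have h3 := h1 1 1
      rw [one_mul] at h2 h3
      rw [← h2, ← h3, mul_one]
    · change x * m.fst 1 = m.snd x
      rw [← h1, mul_one]
  have hu : ∀ b, c b ∈ unitary 𝓜(ℂ, B) ↔ b ∈ unitary B := fun b => by
    rw [Unitary.mem_iff, Unitary.mem_iff, ← StarHomClass.map_star, ← map_mul, ← map_mul, ← hc1,
      hinj.eq_iff, hinj.eq_iff]
  have hdist : ∀ (v : ℕ → B) a n, ‖star (c (v n)) * (φ a : 𝓜(ℂ, B)) * c (v n) -
      (ψ a : 𝓜(ℂ, B))‖ = ‖star (v n) * φ a * v n - ψ a‖ := fun v a n => by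
    change ‖star (c (v n)) * c (φ a) * c (v n) - c (ψ a)‖ = _
    rw [← StarHomClass.map_star, ← map_mul, ← map_mul, ← map_sub, hnorm]
  constructor
  · rintro ⟨v, hv, h⟩
    choose w hw using fun n => hsurj (v n)
    obtain rfl : v = fun n => c (w n) := funext fun n => (hw n).symm
    refine ⟨w, fun n => (hu _).mp (hv n), fun a => ?_⟩
    rw [tendsto_iff_norm_sub_tendsto_zero]
    exact (h a).congr fun n => hdist w a n
  · rintro ⟨v, hv, h⟩
    refine ⟨fun n => c (v n), fun n => (hu _).mpr (hv n), fun a => ?_⟩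
    exact (tendsto_iff_norm_sub_tendsto_zero.mp (h a)).congr fun n => (hdist v a n).symm

theorem norm_star_mul_mul_of_mem_unitary {B : Type u} [CStarAlgebra B] {v : B} (hv : v ∈ unitary B)
    (b : B) : ‖star v * b * v‖ = ‖b‖ := by
  rw [CStarRing.norm_mul_mem_unitary _ hv, CStarRing.norm_mem_unitary_mul _ (Unitary.star_mem hv)]

/-- Two approximate unitary equivalences in commuting subalgebras combine to one. -/
theorem ApproxUnitaryEquiv.prod {A : Type u} {B : Type v} {S T X Y : Type w} [CStarAlgebra S]
    [CStarAlgebra T] [CStarAlgebra X] [CStarAlgebra Y] {α α' : A → S} {β β' : B → T}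
    (hα : ApproxUnitaryEquiv α α') (hβ : ApproxUnitaryEquiv β β') {i : S →⋆ₐ[ℂ] Y}
    {j : T →⋆ₐ[ℂ] Y} (hij : ∀ s t, Commute (i s) (j t)) {Φ Ψ : X →⋆ₐ[ℂ] Y} {K : Set X}
    (hK : Dense (Submodule.span ℂ K : Set X))
    (hΦ : ∀ x ∈ K, ∃ a b, Φ x = i (α a) * j (β b) ∧ Ψ x = i (α' a) * j (β' b)) :
    ApproxUnitaryEquiv Φ Ψ := by
  rw [approxUnitaryEquiv_iff] at hα hβ ⊢
  obtain ⟨v, hv, hvα⟩ := hα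
  obtain ⟨w, hw, hwβ⟩ := hβ
  have hV : ∀ n, i (v n) * j (w n) ∈ unitary Y := fun n =>
    mul_mem (Unitary.map_mem i (hv n)) (Unitary.map_mem j (hw n))
  refine ⟨fun n => i (v n) * j (w n), hV, ?_⟩
  have hspan : ∀ x ∈ Submodule.span ℂ K, Tendsto
      (fun n => star (i (v n) * j (w n)) * Φ x * (i (v n) * j (w n))) atTop (𝓝 (Ψ x)) := by
    intro x hx
    induction hx using Submodule.span_induction with
    | mem x hx =>
      obtain ⟨a, b, h1, h2⟩ := hΦ x hx
      rw [h2]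
      have hi := ((map_continuous i).tendsto _).comp (hvα a)
      have hj := ((map_continuous j).tendsto _).comp (hwβ b)
      refine (hi.mul hj).congr fun n => ?_
      simp only [Function.comp_apply, map_mul, StarHomClass.map_star, h1, star_mul]
      have c1 := (hij (v n) (star (w n))).eq
      have c2 := (hij (star (v n)) (star (w n))).eq
      have c3 := (hij (v n) (β b)).eq
      have c4 := (hij (α a) (star (w n))).eq
      simp only [StarHomClass.map_star] at c1 c2 c4
      calc star (i (v n)) * i (α a) * i (v n) * (star (j (w n)) * j (β b) * j (w n))
          = star (i (v n)) * i (α a) * (i (v n) * star (j (w n))) * j (β b) * j (w n) := by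
            simp only [mul_assoc]
        _ = star (i (v n)) * (i (α a) * star (j (w n))) * (i (v n) * j (β b)) * j (w n) := by
            rw [c1]; simp only [mul_assoc]
        _ = (star (i (v n)) * star (j (w n))) * i (α a) * j (β b) * i (v n) * j (w n) := by
            rw [c3, c4]; simp only [mul_assoc]
        _ = _ := by rw [c2]; simp only [mul_assoc]
    | zero => simp
    | add x y _ _ hx hy =>
      simp only [map_add, mul_add, add_mul]
      exact hx.add hy
    | smul r x _ hx =>
      simp only [map_smul, mul_smul_comm, smul_mul_assoc]
      exact hx.const_smul r
  intro x
  rw [Metric.tendsto_atTop]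
  intro ε hε
  obtain ⟨y, hy, hxy⟩ := Metric.dense_iff.mp hK x (ε / 3) (by positivity)
  rw [Metric.mem_ball, dist_comm, dist_eq_norm] at hy
  obtain ⟨N, hN⟩ := Metric.tendsto_atTop.mp (hspan y hxy) (ε / 3) (by positivity)
  refine ⟨N, fun n hn => ?_⟩
  have h1 := hN n hn
  rw [dist_eq_norm] at h1 ⊢
  set V := i (v n) * j (w n)
  have h2 : ‖star V * Φ (x - y) * V‖ ≤ ‖x - y‖ := by
    rw [norm_star_mul_mul_of_mem_unitary (hV n)]
    exact NonUnitalStarAlgHom.norm_apply_le Φ _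
  have h3 : ‖Ψ (x - y)‖ ≤ ‖x - y‖ := NonUnitalStarAlgHom.norm_apply_le Ψ _
  have h4 : star V * Φ x * V - Ψ x =
      star V * Φ (x - y) * V + (star V * Φ y * V - Ψ y) - Ψ (x - y) := by
    simp only [map_sub, mul_sub, sub_mul]; abel
  rw [h4]
  have h5 := norm_sub_le (star V * Φ (x - y) * V + (star V * Φ y * V - Ψ y)) (Ψ (x - y))
  have h6 := norm_add_le (star V * Φ (x - y) * V) (star V * Φ y * V - Ψ y)
  linarith

/-- The flip on the minimal tensor product of an algebra with itself. -/
theorem MinTensor.exists_flip {A T : Type u} [CStarAlgebra A] [CStarAlgebra T]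
    (h : MinTensor A A T) : ∃ σ : T ≃⋆ₐ[ℂ] T, ∀ a b, σ (h.tmul a b) = h.tmul b a := by
  let h' : CStarTensor A A T :=
    { tmul := fun a b => h.tmul b a
      add_left := fun a a' b => h.add_right b a a'
      add_right := fun a b b' => h.add_left b b' a
      smul_left := fun c a b => h.smul_right c b a
      smul_right := fun c a b => h.smul_left c b a
      mul_tmul := fun a a' b b' => h.mul_tmul b b' a a'
      star_tmul := fun a b => h.star_tmul b a
      norm_tmul := fun a b => by rw [h.norm_tmul, mul_comm]
      dense_span := h.dense_span.mono (Submodule.span_mono (by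
        rintro _ ⟨a, b, rfl⟩; exact ⟨b, a, rfl⟩)) }
  obtain ⟨π, hπ⟩ := h.minimal T h'
  have hπ' : ∀ a b, π (h.tmul a b) = h.tmul b a := fun a b => hπ b a
  have hππ : Function.Involutive π := h.eq_of_forall_tmul (π.comp π)
    (NonUnitalStarAlgHom.id ℂ T) fun a b => by
      rw [NonUnitalStarAlgHom.comp_apply, hπ', hπ', NonUnitalStarAlgHom.coe_id, id]
  exact ⟨StarAlgEquiv.ofBijective π hππ.bijective, hπ'⟩

/-- The rearrangement `(D ⊗ D) ⊗ (E ⊗ E) → (D ⊗ E) ⊗ (D ⊗ E)`, in the form of two commuting star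
homomorphisms, together with a norming functional which it turns into a product functional. -/
theorem exists_rearrangement {D E TD TE P PP : Type u} [CStarAlgebra D] [CStarAlgebra E]
    [CStarAlgebra TD] [CStarAlgebra TE] [CStarAlgebra P] [CStarAlgebra PP]
    [TopologicalSpace.SeparableSpace D] [TopologicalSpace.SeparableSpace E]
    (hD : MinTensor D D TD) (hDu : hD.tmul 1 1 = 1) (hE : MinTensor E E TE)
    (hEu : hE.tmul 1 1 = 1) (hP : MinTensor D E P) (hPu : hP.tmul 1 1 = 1)
    (hPP : MinTensor P P PP) (hPPu : hPP.tmul 1 1 = 1) :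
    ∃ (i : TD →⋆ₐ[ℂ] PP) (j : TE →⋆ₐ[ℂ] PP),
      (∀ a b, i (hD.tmul a b) = hPP.tmul (hP.tmul a 1) (hP.tmul b 1)) ∧
      (∀ a b, j (hE.tmul a b) = hPP.tmul (hP.tmul 1 a) (hP.tmul 1 b)) ∧
      (∀ s t, Commute (i s) (j t)) ∧
      ∃ (l : TD →ₗ[ℂ] ℂ) (m : TE →ₗ[ℂ] ℂ) (χ : PP →ₗ[ℂ] ℂ), IsPosFun l ∧ IsNorming l ∧
        IsPosFun m ∧ IsNorming m ∧ IsPosFun χ ∧ IsNorming χ ∧ ∀ s t, χ (i s * j t) = l s * m t := by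
  obtain ⟨f, hf, hff⟩ := IsPosFun.exists_faithful D
  obtain ⟨g, hg, hgf⟩ := IsPosFun.exists_faithful E
  have hfn := hf.isNorming_of_faithful hff
  have hgn := hg.isNorming_of_faithful hgf
  obtain ⟨l, hl, hlf⟩ := hD.exists_prod hDu hf hf
  obtain ⟨m, hm, hmg⟩ := hE.exists_prod hEu hg hg
  obtain ⟨k, hk, hkfg⟩ := hP.exists_prod hPu hf hg
  obtain ⟨χ, hχ, hχk⟩ := hPP.exists_prod hPPu hk hk
  have hln := hD.isNorming hl hlf hf hf hfn hfn
  have hmn := hE.isNorming hm hmg hg hg hgn hgn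
  have hkn := hP.isNorming hk hkfg hf hg hfn hgn
  have hχn := hPP.isNorming hχ hχk hk hk hkn hkn
  obtain ⟨i, hi⟩ := exists_tensor_self_map hD.toCStarTensor hDu hPP.toCStarTensor hPPu
    (hP.left hPu) hf hχ hχn hχk hP.dense_span (by
      rintro _ ⟨a, b, rfl⟩ _ ⟨a', b', rfl⟩
      refine ⟨a, g (star b * b') • a', fun x => ?_⟩
      rw [CStarTensor.left_apply, hP.star_tmul, hP.mul_tmul, hP.mul_tmul, hkfg, mul_one,
        mul_smul_comm, map_smul, smul_eq_mul, mul_comm])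
  obtain ⟨j, hj⟩ := exists_tensor_self_map hE.toCStarTensor hEu hPP.toCStarTensor hPPu
    (hP.right hPu) hg hχ hχn hχk hP.dense_span (by
      rintro _ ⟨a, b, rfl⟩ _ ⟨a', b', rfl⟩
      refine ⟨b, f (star a * a') • b', fun x => ?_⟩
      rw [CStarTensor.right_apply, hP.star_tmul, hP.mul_tmul, hP.mul_tmul, hkfg, mul_one,
        mul_smul_comm, map_smul, smul_eq_mul])
  simp only [CStarTensor.left_apply] at hi
  simp only [CStarTensor.right_apply] at hj
  let i' : TD →L[ℂ] PP := ⟨i.toAlgHom.toLinearMap, map_continuous i⟩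
  let j' : TE →L[ℂ] PP := ⟨j.toAlgHom.toLinearMap, map_continuous j⟩
  let χ' : PP →L[ℂ] ℂ := ⟨χ, hχ.continuous⟩
  let l' : TD →L[ℂ] ℂ := ⟨l, hl.continuous⟩
  let m' : TE →L[ℂ] ℂ := ⟨m, hm.continuous⟩
  let μ := ContinuousLinearMap.mul ℂ PP
  refine ⟨i, j, hi, hj, fun s t => ?_, l, m, χ, hl, hln, hm, hmn, hχ, hχn, fun s t => ?_⟩
  · refine hD.eq_of_forall_tmul ((μ.flip (j t)).comp i') ((μ (j t)).comp i') (fun a b => ?_) s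
    refine hE.eq_of_forall_tmul ((μ (i (hD.tmul a b))).comp j')
      ((μ.flip (i (hD.tmul a b))).comp j') (fun c d => ?_) t
    change i (hD.tmul a b) * j (hE.tmul c d) = j (hE.tmul c d) * i (hD.tmul a b)
    simp only [hi, hj, hPP.mul_tmul, hP.mul_tmul, one_mul, mul_one]
  · refine hD.eq_of_forall_tmul (χ'.comp ((μ.flip (j t)).comp i')) (m t • l')
      (fun a b => ?_) s |>.trans (mul_comm _ _)
    refine hE.eq_of_forall_tmul (χ'.comp ((μ (i (hD.tmul a b))).comp j'))
      (l (hD.tmul a b) • m') (fun c d => ?_) t |>.trans (mul_comm _ _)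
    change χ (i (hD.tmul a b) * j (hE.tmul c d)) = l (hD.tmul a b) * m (hE.tmul c d)
    simp only [hi, hj, hPP.mul_tmul, hP.mul_tmul, one_mul, mul_one, hχk, hkfg, hlf, hmg]
    ring

theorem IsNorming.comp_equiv {A : Type u} {B : Type v} [CStarAlgebra A] [CStarAlgebra B]
    {f : A →ₗ[ℂ] ℂ} (hf : IsNorming f) (φ : B ≃⋆ₐ[ℂ] A) {g : B →ₗ[ℂ] ℂ}
    (hg : ∀ b, g b = f (φ b)) : IsNorming g := by
  intro b M hM h
  rw [← NonUnitalStarAlgHom.norm_map φ φ.injective]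
  refine hf _ _ hM fun c => ?_
  obtain ⟨c, rfl⟩ : ∃ c', φ c' = c := φ.surjective c
  simpa only [hg, map_mul, StarHomClass.map_star] using h c

theorem isEmpty_starAlgEquiv_complex {D E P : Type u} [CStarAlgebra D] [CStarAlgebra E]
    [CStarAlgebra P] (hP : CStarTensor D E P) (hPu : hP.tmul 1 1 = 1)
    (hD : IsEmpty (D ≃⋆ₐ[ℂ] ℂ)) : IsEmpty (P ≃⋆ₐ[ℂ] ℂ) := by
  refine ⟨fun e => hD.false ?_⟩
  have hE : (1 : E) ≠ 0 := fun h0 => by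
    rw [h0, hP.tmul_zero] at hPu
    exact one_ne_zero (α := ℂ) (by rw [← map_one e, ← hPu, map_zero])
  let f : D →⋆ₐ[ℂ] ℂ := e.toStarAlgHom.comp (hP.left hPu)
  refine StarAlgEquiv.ofBijective f ⟨(injective_iff_map_eq_zero f).mpr fun d hd => ?_, fun c =>
    ⟨algebraMap ℂ D c, AlgHomClass.commutes f c⟩⟩
  have h1 : hP.tmul d 1 = 0 := (map_eq_zero_iff e e.injective).mp hd
  have h2 := hP.norm_tmul d 1
  rw [h1, norm_zero, eq_comm, mul_eq_zero, norm_eq_zero, norm_eq_zero] at h2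
  exact h2.resolve_right hE

/-- Two commuting homomorphisms which together carry a norming functional to a product of norming
functionals induce an isomorphism from the minimal tensor product. -/
theorem exists_starAlgEquiv {A B T Y : Type u} [CStarAlgebra A] [CStarAlgebra B] [CStarAlgebra T]
    [CStarAlgebra Y] (h : MinTensor A B T) (h1 : h.tmul 1 1 = 1) (i : A →⋆ₐ[ℂ] Y)
    (j : B →⋆ₐ[ℂ] Y) (hij : ∀ a b, Commute (i a) (j b)) {l : A →ₗ[ℂ] ℂ} {m : B →ₗ[ℂ] ℂ}
    {χ : Y →ₗ[ℂ] ℂ} (hl : IsPosFun l) (hln : IsNorming l) (hm : IsPosFun m) (hmn : IsNorming m)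
    (hχ : IsPosFun χ) (hχn : IsNorming χ) (hχlm : ∀ a b, χ (i a * j b) = l a * m b)
    (hd : Dense (Submodule.span ℂ {y : Y | ∃ a b, i a * j b = y} : Set Y)) :
    ∃ Φ : T ≃⋆ₐ[ℂ] Y, ∀ a b, Φ (h.tmul a b) = i a * j b := by
  obtain ⟨ψ, hψ, hψlm⟩ := h.exists_prod h1 hl hm
  have hψn := h.isNorming hψ hψlm hl hm hln hmn
  let R : A ⊗[ℂ] B →⋆ₐ[ℂ] Y := tensorLift i j hij
  have hRd : DenseRange R := by
    refine hd.mono (?_ : _ ≤ (LinearMap.range R.toAlgHom.toLinearMap : Set Y))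
    rw [SetLike.coe_subset_coe, Submodule.span_le]
    rintro _ ⟨a, b, rfl⟩
    exact ⟨a ⊗ₜ b, tensorLift_tmul i j hij a b⟩
  have hχR : ∀ w, χ (R w) = ψ (h.hom h1 w) := fun w => by
    induction w with
    | zero => simp
    | add x y hx hy => simp only [map_add, hx, hy]
    | tmul a b => rw [tensorLift_tmul, hχlm, h.hom_tmul, hψlm]
  obtain ⟨Φ, hΦ⟩ := hχn.exists_extension hχ (h.hom h1) (h.denseRange_hom h1) R hRd (by
    rintro _ ⟨z, rfl⟩
    refine ⟨(ψ 1).re * (‖h.hom h1 (star z)‖ * ‖h.hom h1 z‖), fun w => ?_⟩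
    rw [← StarHomClass.map_star, ← map_mul, ← map_mul, hχR]
    refine (hψ.norm_apply_le _).trans ?_
    rw [map_mul, map_mul]
    calc _ ≤ (ψ 1).re * (‖h.hom h1 (star z)‖ * ‖h.hom h1 w‖ * ‖h.hom h1 z‖) := by
          gcongr
          · exact hψ.one_nonneg
          · exact (norm_mul_le _ _).trans (by gcongr; exact norm_mul_le _ _)
      _ = _ := by ring)
  have hΦt : ∀ a b, Φ (h.tmul a b) = i a * j b := fun a b => by
    rw [← h.hom_tmul h1, hΦ, tensorLift_tmul]
  let Φ' : T →L[ℂ] Y := ⟨Φ.toAlgHom.toLinearMap, map_continuous Φ⟩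
  have hχΦ : ∀ t, χ (Φ t) = ψ t :=
    h.eq_of_forall_tmul ((⟨χ, hχ.continuous⟩ : Y →L[ℂ] ℂ).comp Φ')
      (⟨ψ, hψ.continuous⟩ : T →L[ℂ] ℂ) fun a b => by
        change χ (Φ (h.tmul a b)) = ψ (h.tmul a b)
        rw [hΦt, hχlm, hψlm]
  have hinj : Function.Injective Φ := (injective_iff_map_eq_zero Φ).mpr fun t ht => by
    have := hψn t 0 le_rfl fun c => by
      rw [← hχΦ, map_mul Φ, map_mul Φ, map_mul Φ, ht, mul_zero, mul_zero, zero_mul, map_zero,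
        zero_mul, Complex.zero_re]
    simpa using this
  have hsurj : Function.Surjective Φ := by
    rw [← Set.range_eq_univ,
      ← (NonUnitalStarAlgHom.isometry Φ hinj).isClosedEmbedding.isClosed_range.closure_eq]
    refine Dense.closure_eq (hRd.mono ?_)
    rintro _ ⟨w, rfl⟩
    exact ⟨_, hΦ w⟩
  exact ⟨StarAlgEquiv.ofBijective Φ ⟨hinj, hsurj⟩, hΦt⟩

/-- Approximately inner (half) flips and strong self-absorption pass to minimal tensor
products: here `TD ≅ D ⊗ D`, `TE ≅ E ⊗ E`, `P ≅ D ⊗ E` and `PP ≅ (D ⊗ E) ⊗ (D ⊗ E)`. -/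
theorem stmt_3 {D : Type u} {E : Type u} {TD TE P PP : Type u}
    [CStarAlgebra D] [CStarAlgebra E] [CStarAlgebra TD] [CStarAlgebra TE]
    [CStarAlgebra P] [CStarAlgebra PP]
    [TopologicalSpace.SeparableSpace D] [TopologicalSpace.SeparableSpace E]
    (hD : MinTensor D D TD) (hDu : hD.tmul 1 1 = 1)
    (hE : MinTensor E E TE) (hEu : hE.tmul 1 1 = 1)
    (hP : MinTensor D E P) (hPu : hP.tmul 1 1 = 1)
    (hPP : MinTensor P P PP) (hPPu : hPP.tmul 1 1 = 1) :
    -- (i) approximately inner flips pass to tensor products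
    (HasApproxInnerFlip hD → HasApproxInnerFlip hE → HasApproxInnerFlip hPP) ∧
    -- (ii) approximately inner half flips pass to tensor products
    (HasApproxInnerHalfFlip hD → HasApproxInnerHalfFlip hE → HasApproxInnerHalfFlip hPP) ∧
    -- (iii) strong self-absorption passes to tensor products
    (IsStronglySelfAbsorbing hD → IsStronglySelfAbsorbing hE →
      IsStronglySelfAbsorbing hPP) := by
  obtain ⟨i, j, hi, hj, hij, l, m, χ, hl, hln, hm, hmn, hχ, hχn, hχlm⟩ :=
    exists_rearrangement hD hDu hE hEu hP hPu hPP hPPu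
  have hijt : ∀ a b c d, i (hD.tmul a b) * j (hE.tmul c d) =
      hPP.tmul (hP.tmul a c) (hP.tmul b d) := fun a b c d => by
    simp only [hi, hj, hPP.mul_tmul, hP.mul_tmul, one_mul, mul_one]
  have hd : Dense (Submodule.span ℂ {x : PP | ∃ s t, i s * j t = x} : Set PP) := by
    refine (hPP.dense_span_image2 hP.dense_span hP.dense_span).mono (Submodule.span_mono ?_)
    rintro _ ⟨_, ⟨a, b, rfl⟩, _, ⟨c, d, rfl⟩, rfl⟩
    exact ⟨_, _, hijt a c b d⟩
  refine ⟨?_, fun h h' => ?_, ?_⟩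
  · rintro ⟨σ, hσ, h⟩ ⟨τ, hτ, h'⟩
    obtain ⟨ρ, hρ⟩ := hPP.exists_flip
    refine ⟨ρ, hρ, ?_⟩
    have hρi : ∀ s, ρ (i s) = i (σ s) :=
      hD.eq_of_forall_tmul (ρ.toStarAlgHom.comp i) (i.comp σ.toStarAlgHom) fun a b => by
        change ρ (i (hD.tmul a b)) = i (σ (hD.tmul a b))
        rw [hσ, hi, hi, hρ]
    have hρj : ∀ t, ρ (j t) = j (τ t) :=
      hE.eq_of_forall_tmul (ρ.toStarAlgHom.comp j) (j.comp τ.toStarAlgHom) fun a b => by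
        change ρ (j (hE.tmul a b)) = j (τ (hE.tmul a b))
        rw [hτ, hj, hj, hρ]
    refine h.prod h' hij (Φ := ρ.toStarAlgHom) (Ψ := StarAlgHom.id ℂ PP) hd ?_
    rintro _ ⟨s, t, rfl⟩
    refine ⟨s, t, ?_, rfl⟩
    change ρ (i s * j t) = _
    rw [map_mul, hρi, hρj]
  · refine h.prod h' hij (Φ := hPP.left hPPu) (Ψ := hPP.right hPPu) hP.dense_span ?_
    rintro _ ⟨d, e, rfl⟩
    refine ⟨d, e, ?_, ?_⟩
    · rw [MinTensor.fst, MinTensor.fst, hijt, hPu, CStarTensor.left_apply]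
    · rw [MinTensor.snd, MinTensor.snd, hijt, hPu, CStarTensor.right_apply]
  · rintro ⟨hDe, φ, h⟩ ⟨-, ψ, h'⟩
    refine ⟨isEmpty_starAlgEquiv_complex hP.toCStarTensor hPu hDe, ?_⟩
    obtain ⟨Φ, hΦ⟩ := exists_starAlgEquiv hP hPu (i.comp φ.toStarAlgHom) (j.comp ψ.toStarAlgHom)
      (fun a b => hij _ _) (hl.comp φ.toStarAlgHom) (hln.comp_equiv φ fun _ => rfl)
      (hm.comp ψ.toStarAlgHom) (hmn.comp_equiv ψ fun _ => rfl) hχ hχn (fun a b => hχlm _ _) (by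
        refine hd.mono (Submodule.span_mono ?_)
        rintro _ ⟨s, t, rfl⟩
        obtain ⟨d, rfl⟩ : ∃ d, φ d = s := φ.surjective s
        obtain ⟨e, rfl⟩ : ∃ e, ψ e = t := ψ.surjective t
        exact ⟨d, e, rfl⟩)
    refine ⟨Φ, h.prod h' hij (Φ := Φ.toStarAlgHom) (Ψ := hPP.left hPPu) hP.dense_span ?_⟩
    rintro _ ⟨d, e, rfl⟩
    refine ⟨d, e, hΦ d e, ?_⟩
    rw [MinTensor.fst, MinTensor.fst, hijt, hPu, CStarTensor.left_apply]
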